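/- arXiv:1603.06491 — 4 statements merged into one kernel-verified Lean document; each statement's English description precedes it below -/
import Mathlib

section
/- For τ ≥ 2, the Hausdorff dimension of the set A_τ = {x ∈ ℝ : |x − p/q| ≤ C/q^τ for some constant C and infinitely many rationals p/q} is 2/τ, and moreover the (2/τ)-dimensional Hausdorff outer measure of A_τ is infinite. -/
open MeasureTheory

/-- The Jarník set `A_τ` of reals approximable to order `τ`. -/
def Aset (τ : ℝ) : Set ℝ :=
  {x : ℝ | ∃ C > (0:ℝ), {r : ℚ | |x - (r : ℝ)| ≤ C / (r.den : ℝ) ^ τ}.Infinite}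

open Set Filter Topology Metric
open scoped ENNReal

/-! ### Rationals of bounded height -/

theorem Rat.finite_setOf_abs_le_den_le (K : ℝ) (N : ℕ) :
    {r : ℚ | |(r : ℝ)| ≤ K ∧ r.den ≤ N}.Finite := by
  have hfin : ((Icc (-⌈K * N⌉) ⌈K * N⌉) ×ˢ (Iic N) : Set (ℤ × ℕ)).Finite :=
    (finite_Icc _ _).prod (finite_Iic _)
  refine Finite.of_finite_image (f := fun r : ℚ => (r.num, r.den)) (hfin.subset ?_) ?_
  · rintro _ ⟨r, ⟨hr, hN⟩, rfl⟩
    refine ⟨?_, hN⟩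
    have hd : (0 : ℝ) < r.den := by exact_mod_cast r.pos
    have hnum : |(r.num : ℝ)| ≤ K * N := by
      have h1 : (r : ℝ) * r.den = r.num := by exact_mod_cast Rat.mul_den_eq_num r
      have h2 : (r.den : ℝ) ≤ N := by exact_mod_cast hN
      rw [← h1, abs_mul, abs_of_pos hd]
      exact mul_le_mul hr h2 hd.le ((abs_nonneg _).trans hr)
    have hnum' : |r.num| ≤ ⌈K * N⌉ := by
      have : ((|r.num| : ℤ) : ℝ) ≤ ⌈K * N⌉ := by
        push_cast
        exact hnum.trans (Int.le_ceil _)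
      exact_mod_cast this
    exact abs_le.1 hnum'
  · intro r _ r' _ h
    simp only [Prod.mk.injEq] at h
    exact Rat.ext h.1 h.2

/-- If infinitely many rationals lie within distance `1` of `y`, some of them have arbitrarily
large denominator. -/
theorem Rat.exists_mem_den_ge_of_infinite {y : ℝ} {S : Set ℚ} (hS : S.Infinite)
    (hy : ∀ r ∈ S, |y - (r : ℝ)| ≤ 1) (N : ℕ) : ∃ r ∈ S, N ≤ r.den := by
  by_contra! h
  refine hS ((Rat.finite_setOf_abs_le_den_le (|y| + 1) N).subset fun r hr => ⟨?_, (h r hr).le⟩)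
  have h1 := hy r hr
  have h2 : |(r : ℝ)| ≤ |y| + |y - r| := by
    calc |(r : ℝ)| = |y - (y - r)| := by ring_nf
      _ ≤ |y| + |y - r| := abs_sub _ _
  linarith

theorem Irrational.exists_rat_den_ge {y : ℝ} (hy : Irrational y) (N : ℕ) :
    ∃ r : ℚ, N ≤ r.den ∧ |y - (r : ℝ)| < 1 / (r.den : ℝ) ^ 2 := by
  obtain ⟨r, hr, hN⟩ := Rat.exists_mem_den_ge_of_infinite
    (Real.infinite_rat_abs_sub_lt_one_div_den_sq_of_irrational hy) (fun r hr => by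
      have hr' : |y - (r : ℝ)| < 1 / (r.den : ℝ) ^ 2 := hr
      have : (1 : ℝ) ≤ r.den := by exact_mod_cast r.pos
      refine hr'.le.trans ?_
      rw [div_le_one (by positivity)]
      exact one_le_pow₀ this) N
  exact ⟨r, hN, hr⟩

/-! ### The upper bound -/

/-- The convergence half of the Borel–Cantelli lemma for Hausdorff measures. -/
theorem hausdorffMeasure_limsup_eq_zero {X ι : Type*} [EMetricSpace X] [MeasurableSpace X]
    [BorelSpace X] [Countable ι] {d : ℝ} (hd : 0 < d) {B : ι → Set X}
    (hB : ∑' i, ediam (B i) ^ d ≠ ∞) : μH[d] {x | {i | x ∈ B i}.Infinite} = 0 := by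
  have hlim := ENNReal.tendsto_tsum_compl_atTop_zero hB
  have hle := Measure.hausdorffMeasure_le_liminf_tsum (β := Finset ι) (ι := fun F => {i // i ∉ F})
    (l := atTop) d {x | {i | x ∈ B i}.Infinite}
    (fun F => (∑' i : {i // i ∉ F}, ediam (B i) ^ d) ^ d⁻¹)
    (by
      have h := ((ENNReal.continuous_rpow_const (y := d⁻¹)).tendsto 0).comp hlim
      rw [ENNReal.zero_rpow_of_pos (inv_pos.2 hd)] at h
      exact h)
    (fun F i => B i)
    (Eventually.of_forall fun F i => by
      rw [ENNReal.le_rpow_inv_iff hd]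
      exact ENNReal.le_tsum (f := fun i : {i // i ∉ F} => ediam (B i) ^ d) i)
    (Eventually.of_forall fun F x hx => by
      obtain ⟨i, hi, hiF⟩ := Set.Infinite.exists_notMem_finset hx F
      exact mem_iUnion.2 ⟨⟨i, hiF⟩, hi⟩)
  rw [hlim.liminf_eq] at hle
  exact le_antisymm hle zero_le

theorem tsum_rat_den_rpow_ne_top {d : ℝ} (hd : 2 < d) (K : ℕ) :
    ∑' r : {r : ℚ // |(r : ℝ)| ≤ K}, ENNReal.ofReal ((r.1.den : ℝ) ^ (-d)) ≠ ∞ := by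
  let g : ℕ × ℤ → ℝ≥0∞ := fun p =>
    (Icc (-(K * p.1 : ℤ)) (K * p.1)).indicator (fun _ => ENNReal.ofReal ((p.1 : ℝ) ^ (-d))) p.2
  let f : {r : ℚ // |(r : ℝ)| ≤ K} → ℕ × ℤ := fun r => (r.1.den, r.1.num)
  have hf : Function.Injective f := fun r r' h => by
    simp only [f, Prod.mk.injEq] at h
    exact Subtype.ext (Rat.ext h.2 h.1)
  have hfg : ∀ r, ENNReal.ofReal ((r.1.den : ℝ) ^ (-d)) = g (f r) := by
    rintro ⟨r, hr⟩
    have hd : (0 : ℝ) < r.den := by exact_mod_cast r.pos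
    have hnum : |(r.num : ℝ)| ≤ K * r.den := by
      have h1 : (r : ℝ) * r.den = r.num := by exact_mod_cast Rat.mul_den_eq_num r
      rw [← h1, abs_mul, abs_of_pos hd]
      exact mul_le_mul_of_nonneg_right hr hd.le
    have hnum' : |r.num| ≤ (K * r.den : ℤ) := by exact_mod_cast hnum
    exact (indicator_of_mem (s := Icc (-(K * r.den : ℤ)) (K * r.den)) (abs_le.1 hnum')
      (fun _ => ENNReal.ofReal ((r.den : ℝ) ^ (-d)))).symm
  have hsum : ∀ q : ℕ, ∑' p : ℤ, g (q, p) ≤ ENNReal.ofReal ((2 * K + 1) * (q : ℝ) ^ (1 - d)) := by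
    intro q
    rcases Nat.eq_zero_or_pos q with rfl | hq
    · simp [g, Real.zero_rpow (show -d ≠ 0 by linarith)]
    have hq' : (1 : ℝ) ≤ q := by exact_mod_cast hq
    rw [tsum_eq_sum (s := Finset.Icc (-(K * q : ℤ)) (K * q)) (fun p hp => by
      refine indicator_of_notMem ?_ _
      simpa using hp)]
    calc ∑ p ∈ Finset.Icc (-(K * q : ℤ)) (K * q), g (q, p)
        ≤ ∑ p ∈ Finset.Icc (-(K * q : ℤ)) (K * q), ENNReal.ofReal ((q : ℝ) ^ (-d)) :=
          Finset.sum_le_sum fun p _ => indicator_le_self' (fun _ _ => zero_le) _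
      _ = (2 * K * q + 1 : ℕ) * ENNReal.ofReal ((q : ℝ) ^ (-d)) := by
          rw [Finset.sum_const, nsmul_eq_mul, Int.card_Icc]
          congr 2
          lia
      _ = ENNReal.ofReal ((2 * K * q + 1 : ℕ) * (q : ℝ) ^ (-d)) := by
          rw [ENNReal.ofReal_mul (by positivity), ENNReal.ofReal_natCast]
      _ ≤ _ := by
          apply ENNReal.ofReal_le_ofReal
          rw [show (1 : ℝ) - d = -d + 1 by ring, Real.rpow_add_one (by positivity)]
          have : (0 : ℝ) ≤ (q : ℝ) ^ (-d) := by positivity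
          push_cast
          nlinarith
  have hsummable : Summable fun q : ℕ => (2 * K + 1) * (q : ℝ) ^ (1 - d) :=
    (Real.summable_nat_rpow.2 (by linarith)).mul_left _
  refine ne_top_of_le_ne_top hsummable.tsum_ofReal_ne_top ?_
  calc ∑' r : {r : ℚ // |(r : ℝ)| ≤ K}, ENNReal.ofReal ((r.1.den : ℝ) ^ (-d))
      = ∑' r, g (f r) := tsum_congr hfg
    _ ≤ ∑' p, g p := ENNReal.tsum_comp_le_tsum_of_injective hf g
    _ = ∑' q, ∑' p, g (q, p) := ENNReal.tsum_prod'
    _ ≤ _ := ENNReal.tsum_le_tsum hsum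

theorem hausdorffMeasure_Aset_eq_zero {τ d : ℝ} (hτ : 0 < τ) (hd : 2 / τ < d) :
    μH[d] (Aset τ) = 0 := by
  have hd0 : 0 < d := (by positivity : 0 < 2 / τ).trans hd
  have hτd : 2 < τ * d := by rwa [div_lt_iff₀' hτ] at hd
  let B : (M : ℕ) → {r : ℚ // |(r : ℝ)| ≤ (2 * M : ℕ)} → Set ℝ :=
    fun M r => closedBall (r.1 : ℝ) (M / (r.1.den : ℝ) ^ τ)
  have hB : ∀ M, μH[d] {x | {r | x ∈ B M r}.Infinite} = 0 := by
    intro M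
    refine hausdorffMeasure_limsup_eq_zero hd0 ?_
    have hdiam : ∀ r, ediam (B M r) ^ d ≤
        ENNReal.ofReal ((2 * M) ^ d) * ENNReal.ofReal ((r.1.den : ℝ) ^ (-(τ * d))) := by
      intro r
      have hr : (0 : ℝ) < r.1.den := by exact_mod_cast r.1.pos
      calc ediam (B M r) ^ d
          = (ENNReal.ofReal (2 * (M / (r.1.den : ℝ) ^ τ))) ^ d := by
            rw [show B M r = closedBall _ _ from rfl, Real.closedBall_eq_Icc, Real.ediam_Icc]
            ring_nf
        _ = ENNReal.ofReal ((2 * M) ^ d * (r.1.den : ℝ) ^ (-(τ * d))) := by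
            rw [ENNReal.ofReal_rpow_of_nonneg (by positivity) hd0.le, ← mul_div_assoc,
              Real.div_rpow (by positivity) (by positivity), ← Real.rpow_mul hr.le,
              Real.rpow_neg hr.le, div_eq_mul_inv]
        _ ≤ _ := (ENNReal.ofReal_mul (by positivity)).le
    refine ne_top_of_le_ne_top ?_ (ENNReal.tsum_le_tsum hdiam)
    rw [ENNReal.tsum_mul_left]
    exact ENNReal.mul_ne_top ENNReal.ofReal_ne_top (tsum_rat_den_rpow_ne_top hτd (2 * M))
  refine measure_mono_null ?_ (measure_iUnion_null hB)
  rintro x ⟨C, hC, hx⟩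
  obtain ⟨M, hM⟩ := exists_nat_ge (max C |x|)
  refine mem_iUnion.2 ⟨M, ?_⟩
  have hmem : ∀ r ∈ {r : ℚ | |x - (r : ℝ)| ≤ C / (r.den : ℝ) ^ τ},
      |x - (r : ℝ)| ≤ M / (r.den : ℝ) ^ τ ∧ |(r : ℝ)| ≤ (2 * M : ℕ) := by
    intro r hr
    have hr1 : (1 : ℝ) ≤ r.den := by exact_mod_cast r.pos
    have hpow : (1 : ℝ) ≤ (r.den : ℝ) ^ τ := Real.one_le_rpow hr1 hτ.le
    have h1 : |x - (r : ℝ)| ≤ M / (r.den : ℝ) ^ τ :=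
      (show |x - (r : ℝ)| ≤ C / (r.den : ℝ) ^ τ from hr).trans
        (by gcongr; exact (le_max_left _ _).trans hM)
    refine ⟨h1, ?_⟩
    have h2 : |(r : ℝ)| ≤ |x| + |x - r| := by
      calc |(r : ℝ)| = |x - (x - r)| := by ring_nf
        _ ≤ |x| + |x - r| := abs_sub _ _
    have h3 : (M : ℝ) / (r.den : ℝ) ^ τ ≤ M := div_le_self (by positivity) hpow
    have h4 := (le_max_right C |x|).trans hM
    push_cast
    linarith
  intro hfin
  refine hx ((hfin.image Subtype.val).subset fun r hr => ⟨⟨r, (hmem r hr).2⟩, ?_, rfl⟩)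
  simpa [B, Real.dist_eq] using (hmem r hr).1

theorem dimH_Aset_le {τ : ℝ} (hτ : 0 < τ) : dimH (Aset τ) ≤ ENNReal.ofReal (2 / τ) := by
  refine dimH_le fun d hd => ?_
  by_contra! h
  rw [← ENNReal.ofReal_coe_nnreal, ENNReal.ofReal_lt_ofReal_iff_of_nonneg (by positivity)] at h
  simp [hausdorffMeasure_Aset_eq_zero hτ h] at hd

/-! ### The lower bound -/

/-- The rationals in a closed interval carry disjoint intervals of radius `1 / den ^ 2` with
arbitrarily large denominators, covering a fixed proportion of the interval. -/
theorem exists_pairwiseDisjoint_rat_closedBall (x ℓ : ℝ) (N : ℕ) :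
    ∃ u : Set ℚ, (∀ r ∈ u, N ≤ r.den) ∧
      (∀ r ∈ u, closedBall (r : ℝ) (1 / (r.den : ℝ) ^ 2) ⊆ closedBall x ℓ) ∧
      (u.PairwiseDisjoint fun r => closedBall (r : ℝ) (1 / (r.den : ℝ) ^ 2)) ∧
      ENNReal.ofReal (2 * ℓ) ≤
        5 * ∑' r : u, volume (closedBall ((r : ℚ) : ℝ) (1 / ((r : ℚ).den : ℝ) ^ 2)) := by
  obtain ⟨u, hut, hdisj, hcov⟩ := Vitali.exists_disjoint_subfamily_covering_enlargement_closedBall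
    {r : ℚ | N ≤ r.den ∧ closedBall (r : ℝ) (1 / (r.den : ℝ) ^ 2) ⊆ closedBall x ℓ}
    (fun r => (r : ℝ)) (fun r => 1 / (r.den : ℝ) ^ 2) 1
    (fun r _ => by
      have : (1 : ℝ) ≤ r.den := by exact_mod_cast r.pos
      rw [div_le_one (by positivity)]
      exact one_le_pow₀ this) 5 (by norm_num)
  refine ⟨u, fun r hr => (hut hr).1, fun r hr => (hut hr).2, hdisj, ?_⟩
  have hsub : ball x ℓ \ range ((↑) : ℚ → ℝ) ⊆
      ⋃ r : u, closedBall ((r : ℚ) : ℝ) (5 * (1 / ((r : ℚ).den : ℝ) ^ 2)) := by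
    rintro y ⟨hy, hirr⟩
    have hy' : 0 < ℓ - dist y x := sub_pos.2 hy
    obtain ⟨N', hN'⟩ := exists_nat_gt (max 1 (2 / (ℓ - dist y x)))
    obtain ⟨r, hrN, hr⟩ := Irrational.exists_rat_den_ge hirr (max N N')
    have hrN' : (N' : ℝ) ≤ r.den := by exact_mod_cast (le_max_right _ _).trans hrN
    have h1 : (1 : ℝ) < r.den := ((le_max_left _ _).trans_lt hN').trans_le hrN'
    have h2 : 2 / (ℓ - dist y x) < r.den := ((le_max_right _ _).trans_lt hN').trans_le hrN'
    have h3 : 2 * (1 / (r.den : ℝ) ^ 2) ≤ ℓ - dist y x := by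
      rw [div_lt_iff₀ hy'] at h2
      rw [mul_one_div, div_le_iff₀ (by positivity)]
      nlinarith
    have hyr : y ∈ closedBall (r : ℝ) (1 / (r.den : ℝ) ^ 2) := by
      simpa [Real.dist_eq] using hr.le
    have hrt : closedBall (r : ℝ) (1 / (r.den : ℝ) ^ 2) ⊆ closedBall x ℓ := by
      refine closedBall_subset_closedBall' ?_
      have := dist_triangle (r : ℝ) y x
      rw [mem_closedBall, dist_comm] at hyr
      linarith
    obtain ⟨b, hb, hrb⟩ := hcov r ⟨(le_max_left _ _).trans hrN, hrt⟩
    exact mem_iUnion.2 ⟨⟨b, hb⟩, hrb hyr⟩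
  calc ENNReal.ofReal (2 * ℓ) = volume (ball x ℓ \ range ((↑) : ℚ → ℝ)) := by
        rw [measure_sdiff_null ((countable_range _).measure_zero _), Real.volume_ball]
    _ ≤ ∑' r : u, volume (closedBall ((r : ℚ) : ℝ) (5 * (1 / ((r : ℚ).den : ℝ) ^ 2))) :=
        (measure_mono hsub).trans (measure_iUnion_le _)
    _ = _ := by
        rw [← ENNReal.tsum_mul_left]
        refine tsum_congr fun r => ?_
        rw [Real.volume_closedBall, Real.volume_closedBall, mul_left_comm,
          ENNReal.ofReal_mul (by norm_num), ENNReal.ofReal_ofNat]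

theorem ENNReal.tsum_indicator_const_le_of_subsingleton {α : Type*} {S : Set α}
    (hS : S.Subsingleton) (c : ℝ≥0∞) : ∑' x, S.indicator (fun _ => c) x ≤ c := by
  rcases hS.eq_empty_or_singleton with rfl | ⟨x, rfl⟩
  · simp
  · rw [tsum_eq_single x fun y hy => indicator_of_notMem (by simpa using hy) _]
    simp

/-- The total weight, with respect to `a`, of those sets of the family `U` that meet `B`. -/
noncomputable def hitSum {ι X : Type*} (U : ι → Set X) (a : ι → ℝ≥0∞) (B : Set X) : ℝ≥0∞ :=
  ∑' i, {i | (U i ∩ B).Nonempty}.indicator a i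

/-- The members of a disjoint family of intervals in `closedBall x ℓ` which are hit by comparatively
large sets `U i` have small total length, as long as the `U i` have small total weight. -/
theorem tsum_volume_hit_le {ι : Type*} {s : ℝ} (hs0 : 0 < s) (hs1 : s ≤ 1) {U : ι → Set ℝ}
    {w : ι → ℝ} (hw : ∀ i, 0 < w i) (hU : ∀ i, ∀ y ∈ U i, ∀ z ∈ U i, dist y z ≤ w i)
    {x ℓ δ : ℝ} (hδ : 0 < δ)
    (hsum : hitSum U (fun i => ENNReal.ofReal (w i ^ s)) (closedBall x ℓ) <
      ENNReal.ofReal (δ ^ s))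
    {u : Set ℚ} {ρ ρ' : ℚ → ℝ} (hρ : ∀ r ∈ u, ρ' r ≤ ρ r)
    (hsub : ∀ r ∈ u, closedBall (r : ℝ) (ρ r) ⊆ closedBall x ℓ)
    (hdisj : u.PairwiseDisjoint fun r => closedBall (r : ℝ) (ρ r)) :
    ∑' r : u, ∑' i,
      {i | (U i ∩ closedBall ((r : ℚ) : ℝ) (ρ' r)).Nonempty ∧ ρ r / 2 ≤ w i}.indicator
        (fun _ => volume (closedBall ((r : ℚ) : ℝ) (ρ r))) i ≤ ENNReal.ofReal (10 * δ) := by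
  set a : ι → ℝ≥0∞ := fun i => ENNReal.ofReal (w i ^ s) with ha
  have hinner : ∀ i, ∑' r : u,
      {i | (U i ∩ closedBall ((r : ℚ) : ℝ) (ρ' r)).Nonempty ∧ ρ r / 2 ≤ w i}.indicator
        (fun _ => volume (closedBall ((r : ℚ) : ℝ) (ρ r))) i ≤
      ENNReal.ofReal (10 * δ ^ (1 - s)) * {i | (U i ∩ closedBall x ℓ).Nonempty}.indicator a i := by
    intro i
    let v : Set u :=
      {r | (U i ∩ closedBall ((r : ℚ) : ℝ) (ρ' r)).Nonempty ∧ ρ r / 2 ≤ w i}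
    have hcomm : ∀ r : u,
        {i | (U i ∩ closedBall ((r : ℚ) : ℝ) (ρ' r)).Nonempty ∧ ρ r / 2 ≤ w i}.indicator
          (fun _ => volume (closedBall ((r : ℚ) : ℝ) (ρ r))) i =
        v.indicator (fun r => volume (closedBall ((r : ℚ) : ℝ) (ρ r))) r := fun r => rfl
    simp_rw [hcomm]
    rw [← tsum_subtype]
    rcases v.eq_empty_or_nonempty with hv | ⟨r₀, ⟨y, hyU, hy⟩, hr₀⟩
    · have : IsEmpty v := isEmpty_coe_sort.2 hv
      simp
    have hhit : i ∈ {i | (U i ∩ closedBall x ℓ).Nonempty} :=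
      ⟨y, hyU, hsub r₀ r₀.2 (closedBall_subset_closedBall (hρ r₀ r₀.2) hy)⟩
    have hwi : w i < δ := by
      have h1 : a i < ENNReal.ofReal (δ ^ s) := by
        refine lt_of_le_of_lt ?_ hsum
        rw [← indicator_of_mem hhit a]
        exact ENNReal.le_tsum i
      rw [ha, ENNReal.ofReal_lt_ofReal_iff (by positivity)] at h1
      exact (Real.rpow_lt_rpow_iff (hw i).le hδ.le hs0).1 h1
    rw [indicator_of_mem hhit]
    calc ∑' r : v, volume (closedBall ((r : ℚ) : ℝ) (ρ r))
        ≤ volume (⋃ r : v, closedBall ((r : ℚ) : ℝ) (ρ r)) := by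
          refine tsum_meas_le_meas_iUnion_of_disjoint _ (fun _ => measurableSet_closedBall) ?_
          intro r r' hrr'
          exact hdisj r.1.2 r'.1.2 fun h => hrr' (Subtype.ext (Subtype.ext h))
      _ ≤ volume (closedBall y (5 * w i)) := by
          refine measure_mono (iUnion_subset ?_)
          rintro ⟨r, ⟨z, hzU, hz⟩, hr⟩
          refine closedBall_subset_closedBall' ?_
          have h1 : dist z (r : ℝ) ≤ ρ r := (mem_closedBall.1 hz).trans (hρ r r.2)
          have h2 := hU i z hzU y hyU
          have h3 := dist_triangle_left ((r : ℚ) : ℝ) y z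
          have h4 : ρ r / 2 ≤ w i := hr
          change ρ r + dist ((r : ℚ) : ℝ) y ≤ 5 * w i
          linarith
      _ = ENNReal.ofReal (10 * w i) := by
          rw [Real.volume_closedBall]
          ring_nf
      _ ≤ ENNReal.ofReal (10 * δ ^ (1 - s) * w i ^ s) := by
          apply ENNReal.ofReal_le_ofReal
          have h1 : w i = w i ^ (1 - s) * w i ^ s := by
            rw [← Real.rpow_add (hw i)]
            simp
          have h2 : w i ^ (1 - s) ≤ δ ^ (1 - s) :=
            Real.rpow_le_rpow (hw i).le hwi.le (by linarith)
          have h3 : 0 ≤ w i ^ s := Real.rpow_nonneg (hw i).le _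
          nlinarith
      _ = _ := ENNReal.ofReal_mul (by positivity)
  rw [ENNReal.tsum_comm]
  calc _ ≤ ∑' i, ENNReal.ofReal (10 * δ ^ (1 - s)) *
        {i | (U i ∩ closedBall x ℓ).Nonempty}.indicator a i := ENNReal.tsum_le_tsum hinner
    _ = ENNReal.ofReal (10 * δ ^ (1 - s)) * hitSum U a (closedBall x ℓ) := ENNReal.tsum_mul_left
    _ ≤ ENNReal.ofReal (10 * δ ^ (1 - s)) * ENNReal.ofReal (δ ^ s) := by gcongr
    _ = _ := by
        rw [← ENNReal.ofReal_mul (by positivity), mul_assoc, ← Real.rpow_add hδ]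
        simp

/-- If a disjoint family of intervals shrinks by at least one half, then the small sets of a family
`U` meet at most one of the shrunken intervals each. -/
theorem tsum_hit_small_le {ι : Type*} {U : ι → Set ℝ} {w : ι → ℝ}
    (hU : ∀ i, ∀ y ∈ U i, ∀ z ∈ U i, dist y z ≤ w i) (a : ι → ℝ≥0∞) {F : Finset ι}
    {u : Set ℚ} {ρ ρ' : ℚ → ℝ} (hρ : ∀ r ∈ u, ρ' r ≤ ρ r / 2)
    (hF : ∀ r ∈ u, ∀ i ∈ F, ρ r / 2 ≤ w i)
    (hdisj : u.PairwiseDisjoint fun r => closedBall (r : ℝ) (ρ r)) :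
    ∑' r : u, ∑' i,
      {i | (U i ∩ closedBall ((r : ℚ) : ℝ) (ρ' r)).Nonempty ∧ w i < ρ r / 2}.indicator a i ≤
      ∑' i : {i // i ∉ F}, a i := by
  rw [ENNReal.tsum_comm]
  refine (ENNReal.tsum_le_tsum fun i => ?_).trans_eq (tsum_subtype {i | i ∉ F} a).symm
  by_cases hiF : i ∈ F
  · rw [ENNReal.tsum_eq_zero.2]
    · exact zero_le
    · exact fun r => indicator_of_notMem (fun h => (hF r r.2 i hiF).not_gt h.2) _
  rw [indicator_of_mem (show i ∈ {i | i ∉ F} from hiF)]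
  refine ENNReal.tsum_indicator_const_le_of_subsingleton
    (S := {r : u | (U i ∩ closedBall ((r : ℚ) : ℝ) (ρ' r)).Nonempty ∧ w i < ρ r / 2}) ?_ (a i)
  rintro r ⟨⟨y, hyU, hy⟩, hr⟩ r' ⟨⟨z, hzU, hz⟩, hr'⟩
  refine Subtype.ext (hdisj.elim_set r.2 r'.2 z ?_ ?_)
  · have h1 := hU i z hzU y hyU
    have h2 := hρ r r.2
    have h3 := dist_triangle z y ((r : ℚ) : ℝ)
    rw [mem_closedBall] at hy ⊢
    linarith
  · have h1 := hρ r' r'.2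
    have h2 : (0 : ℝ) ≤ ρ' r' := dist_nonneg.trans hz
    exact closedBall_subset_closedBall (by linarith) hz

/-- Inside an interval which only meets a small part of a family `U`, there is an interval around a
rational of large denominator with the same property. -/
theorem exists_rat_closedBall_hitSum_lt {ι : Type*} {τ : ℝ} (hτ : 2 < τ) {U : ι → Set ℝ}
    {w : ι → ℝ} (hw : ∀ i, 0 < w i) (hU : ∀ i, ∀ y ∈ U i, ∀ z ∈ U i, dist y z ≤ w i)
    (htot : ∑' i, ENNReal.ofReal (w i ^ (2 / τ)) ≠ ∞) {x ℓ : ℝ} (hℓ : 0 < ℓ)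
    (hsum : hitSum U (fun i => ENNReal.ofReal (w i ^ (2 / τ))) (closedBall x ℓ) <
      ENNReal.ofReal ((ℓ / 50) ^ (2 / τ))) (N : ℕ) :
    ∃ r : ℚ, N ≤ r.den ∧ closedBall (r : ℝ) (1 / (r.den : ℝ) ^ τ) ⊆ closedBall x ℓ ∧
      hitSum U (fun i => ENNReal.ofReal (w i ^ (2 / τ)))
        (closedBall (r : ℝ) (1 / (r.den : ℝ) ^ τ)) <
        ENNReal.ofReal ((1 / (r.den : ℝ) ^ τ / 50) ^ (2 / τ)) := by
  have hτ0 : 0 < τ := by linarith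
  have hs0 : 0 < 2 / τ := by positivity
  have hs1 : 2 / τ ≤ 1 := by
    rw [div_le_one hτ0]
    exact hτ.le
  set a : ι → ℝ≥0∞ := fun i => ENNReal.ofReal (w i ^ (2 / τ))
  set K : ℝ := 2 * 50 ^ (2 / τ) with hK
  have hK0 : 0 < K := by positivity
  obtain ⟨F, hFε⟩ : ∃ F : Finset ι, ∑' i : {i // i ∉ F}, a i < ENNReal.ofReal (ℓ / (5 * K)) :=
    ((ENNReal.tendsto_tsum_compl_atTop_zero htot).eventually
      (gt_mem_nhds (ENNReal.ofReal_pos.2 (by positivity)))).exists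
  obtain ⟨N', hN'N, hN'0, hN'τ, hN'F⟩ : ∃ N' : ℕ, N ≤ N' ∧ 0 < N' ∧
      (∀ q : ℕ, N' ≤ q → (q : ℝ) ^ (-(τ - 2)) ≤ 1 / 2) ∧
      ∀ i ∈ F, ∀ q : ℕ, N' ≤ q → (q : ℝ) ^ (-2 : ℝ) ≤ 2 * w i := by
    have hev : ∀ {p c : ℝ}, 0 < p → 0 < c →
        ∀ᶠ n : ℕ in atTop, ∀ q : ℕ, n ≤ q → (q : ℝ) ^ (-p) ≤ c := fun {p c} hp hc =>
      eventually_forall_ge_atTop.2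
        (((tendsto_rpow_neg_atTop hp).comp tendsto_natCast_atTop_atTop).eventually
          (ge_mem_nhds hc))
    exact ((eventually_ge_atTop N).and ((eventually_gt_atTop 0).and
      ((hev (by linarith) (by norm_num)).and ((Finset.eventually_all F).2 fun i _ =>
        hev two_pos (mul_pos two_pos (hw i)))))).exists
  obtain ⟨u, huN, hsub, hdisj, hvol⟩ := exists_pairwiseDisjoint_rat_closedBall x ℓ N'
  by_contra! hcon
  have hpos : ∀ r : ℚ, (0 : ℝ) < r.den := fun r => by exact_mod_cast r.pos
  have hhalf : ∀ r ∈ u, 1 / (r.den : ℝ) ^ τ ≤ 1 / (r.den : ℝ) ^ 2 / 2 := by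
    intro r hr
    have h1 := hN'τ r.den (huN r hr)
    have h2 : 1 / (r.den : ℝ) ^ τ = (r.den : ℝ) ^ (-(τ - 2)) * (1 / (r.den : ℝ) ^ 2) := by
      rw [one_div, one_div, ← Real.rpow_neg (hpos r).le, ← Real.rpow_natCast,
        ← Real.rpow_neg (hpos r).le, ← Real.rpow_add (hpos r)]
      congr 1
      push_cast
      ring
    have h3 : 0 < 1 / (r.den : ℝ) ^ 2 := by have := hpos r; positivity
    rw [h2]
    nlinarith
  have hle : ∀ r ∈ u, 1 / (r.den : ℝ) ^ τ ≤ 1 / (r.den : ℝ) ^ 2 := fun r hr =>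
    (hhalf r hr).trans (half_le_self (by positivity))
  have hF : ∀ r ∈ u, ∀ i ∈ F, 1 / (r.den : ℝ) ^ 2 / 2 ≤ w i := by
    intro r hr i hi
    have h1 := hN'F i hi r.den (huN r hr)
    rw [Real.rpow_neg (hpos r).le, Real.rpow_two, ← one_div] at h1
    linarith
  have hbound : ∀ r : u, volume (closedBall ((r : ℚ) : ℝ) (1 / ((r : ℚ).den : ℝ) ^ 2)) ≤
      ∑' i, {i | (U i ∩ closedBall ((r : ℚ) : ℝ) (1 / ((r : ℚ).den : ℝ) ^ τ)).Nonempty ∧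
          1 / ((r : ℚ).den : ℝ) ^ 2 / 2 ≤ w i}.indicator
        (fun _ => volume (closedBall ((r : ℚ) : ℝ) (1 / ((r : ℚ).den : ℝ) ^ 2))) i +
      ENNReal.ofReal K *
        ∑' i, {i | (U i ∩ closedBall ((r : ℚ) : ℝ) (1 / ((r : ℚ).den : ℝ) ^ τ)).Nonempty ∧
          w i < 1 / ((r : ℚ).den : ℝ) ^ 2 / 2}.indicator a i := by
    rintro ⟨r, hr⟩
    by_cases hbad : ∃ i, i ∈ {i | (U i ∩ closedBall (r : ℝ) (1 / (r.den : ℝ) ^ τ)).Nonempty ∧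
        1 / (r.den : ℝ) ^ 2 / 2 ≤ w i}
    · obtain ⟨i, hi⟩ := hbad
      refine le_add_right ?_
      refine le_trans ?_ (ENNReal.le_tsum i)
      rw [indicator_of_mem hi]
    · refine le_add_left ?_
      have hset : {i | (U i ∩ closedBall (r : ℝ) (1 / (r.den : ℝ) ^ τ)).Nonempty ∧
          w i < 1 / (r.den : ℝ) ^ 2 / 2} =
          {i | (U i ∩ closedBall (r : ℝ) (1 / (r.den : ℝ) ^ τ)).Nonempty} := by
        ext i
        exact ⟨fun h => h.1, fun h => ⟨h, not_le.1 fun h' => hbad ⟨i, h, h'⟩⟩⟩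
      have h1 := hcon r (hN'N.trans (huN r hr))
        ((closedBall_subset_closedBall (hle r hr)).trans (hsub r hr))
      rw [hset]
      refine le_trans (le_of_eq ?_) (mul_le_mul_right h1 (ENNReal.ofReal K))
      rw [Real.volume_closedBall, ← ENNReal.ofReal_mul hK0.le, hK,
        Real.div_rpow (by positivity) (by norm_num), Real.div_rpow zero_le_one (by positivity),
        Real.one_rpow, ← Real.rpow_mul (hpos r).le, mul_div_cancel₀ _ hτ0.ne', Real.rpow_two]
      congr 1
      have : (0 : ℝ) < 50 ^ (2 / τ) := by positivity
      field_simp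
  have hbig := tsum_volume_hit_le hs0 hs1 hw hU (by positivity) hsum hle hsub hdisj
  have hsmall := tsum_hit_small_le hU a hhalf hF hdisj
  have hfinal : ENNReal.ofReal (2 * ℓ) < ENNReal.ofReal (2 * ℓ) := by
    calc ENNReal.ofReal (2 * ℓ)
        ≤ 5 * ∑' r : u, volume (closedBall ((r : ℚ) : ℝ) (1 / ((r : ℚ).den : ℝ) ^ 2)) := hvol
      _ ≤ 5 * (ENNReal.ofReal (10 * (ℓ / 50)) +
            ENNReal.ofReal K * ∑' i : {i // i ∉ F}, a i) := by
          gcongr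
          refine (ENNReal.tsum_le_tsum hbound).trans ?_
          rw [ENNReal.tsum_add, ENNReal.tsum_mul_left]
          gcongr
      _ < 5 * (ENNReal.ofReal (10 * (ℓ / 50)) +
            ENNReal.ofReal K * ENNReal.ofReal (ℓ / (5 * K))) := by
          refine (ENNReal.mul_lt_mul_iff_right (by norm_num) (by norm_num)).2 ?_
          refine (ENNReal.add_lt_add_iff_left ENNReal.ofReal_ne_top).2 ?_
          exact (ENNReal.mul_lt_mul_iff_right (ENNReal.ofReal_pos.2 hK0).ne'
            ENNReal.ofReal_ne_top).2 hFε
      _ = ENNReal.ofReal (2 * ℓ) := by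
          rw [← ENNReal.ofReal_mul hK0.le, ← ENNReal.ofReal_add (by positivity) (by positivity),
            ← ENNReal.ofReal_ofNat 5, ← ENNReal.ofReal_mul (by norm_num)]
          congr 1
          field_simp
          norm_num
  exact hfinal.false

/-- Every countable cover of `Aset τ ∩ closedBall x ℓ` has `2 / τ`-dimensional weight at least a
constant multiple of `ℓ ^ (2 / τ)`. -/
theorem ofReal_rpow_le_tsum_of_Aset_inter_subset {ι : Type*} {τ : ℝ} (hτ : 2 < τ)
    {U : ι → Set ℝ} {w : ι → ℝ} (hw : ∀ i, 0 < w i)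
    (hU : ∀ i, ∀ y ∈ U i, ∀ z ∈ U i, dist y z ≤ w i) {x ℓ : ℝ} (hℓ : 0 < ℓ)
    (hcov : Aset τ ∩ closedBall x ℓ ⊆ ⋃ i, U i) :
    ENNReal.ofReal ((ℓ / 50) ^ (2 / τ)) ≤ ∑' i, ENNReal.ofReal (w i ^ (2 / τ)) := by
  by_contra! hlt
  have hτ0 : 0 < τ := by linarith
  set a : ι → ℝ≥0∞ := fun i => ENNReal.ofReal (w i ^ (2 / τ))
  have hpos : ∀ r : ℚ, (0 : ℝ) < r.den := fun r => by exact_mod_cast r.pos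
  let Good := {r : ℚ // hitSum U a (closedBall (r : ℝ) (1 / (r.den : ℝ) ^ τ)) <
    ENNReal.ofReal ((1 / (r.den : ℝ) ^ τ / 50) ^ (2 / τ))}
  let J : Good → Set ℝ := fun g => closedBall ((g.1 : ℚ) : ℝ) (1 / (g.1.den : ℝ) ^ τ)
  have hstart : ∃ g : Good, J g ⊆ closedBall x ℓ := by
    have hsum : hitSum U a (closedBall x ℓ) ≤ ∑' i, a i :=
      ENNReal.tsum_le_tsum fun i => indicator_le_self _ _ i
    obtain ⟨r, -, hr, hr'⟩ :=
      exists_rat_closedBall_hitSum_lt hτ hw hU hlt.ne_top hℓ (hsum.trans_lt hlt) 0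
    exact ⟨⟨r, hr'⟩, hr⟩
  have hnext : ∀ g : Good, ∃ g' : Good, g.1.den < g'.1.den ∧ J g' ⊆ J g := by
    intro g
    have := hpos g.1
    obtain ⟨r, hN, hr, hr'⟩ :=
      exists_rat_closedBall_hitSum_lt hτ hw hU hlt.ne_top (by positivity) g.2 (g.1.den + 1)
    exact ⟨⟨r, hr'⟩, hN, hr⟩
  obtain ⟨g₀, hg₀⟩ := hstart
  choose next hden hJ using hnext
  let g : ℕ → Good := fun n => next^[n] g₀
  have hg : ∀ n, g (n + 1) = next (g n) := fun n => Function.iterate_succ_apply' next n g₀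
  have hmono : StrictMono fun n => (g n).1.den :=
    strictMono_nat_of_lt_succ fun n => by simpa only [hg] using hden (g n)
  have hne : ∀ r : Good, (J r).Nonempty := fun r =>
    nonempty_closedBall.2 (by have := hpos r.1; positivity)
  obtain ⟨y, hy⟩ := IsCompact.nonempty_iInter_of_sequence_nonempty_isCompact_isClosed
    (fun n => J (g n)) (fun n => by simpa only [hg] using hJ (g n)) (fun n => hne _)
    (isCompact_closedBall _ _) (fun n => isClosed_closedBall)
  rw [mem_iInter] at hy
  have hyA : y ∈ Aset τ := by
    refine ⟨1, one_pos, ?_⟩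
    refine (infinite_range_of_injective (f := fun n => (g n).1) fun m n h =>
      hmono.injective (congrArg Rat.den h)).mono ?_
    rintro _ ⟨n, rfl⟩
    exact hy n
  obtain ⟨i, hi⟩ := mem_iUnion.1 (hcov ⟨hyA, hg₀ (hy 0)⟩)
  have hwi : ∀ n, w i ≤ 1 / ((g n).1.den : ℝ) ^ τ := by
    intro n
    have hb : 0 < 1 / ((g n).1.den : ℝ) ^ τ := by have := hpos (g n).1; positivity
    have h1 : a i < ENNReal.ofReal ((1 / ((g n).1.den : ℝ) ^ τ / 50) ^ (2 / τ)) := by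
      refine lt_of_le_of_lt ?_ (g n).2
      rw [← indicator_of_mem (show i ∈ {i | (U i ∩ J (g n)).Nonempty} from ⟨y, hi, hy n⟩) a]
      exact ENNReal.le_tsum i
    have h2 := (ENNReal.ofReal_lt_ofReal_iff (by positivity)).1 h1
    have h3 := (Real.rpow_lt_rpow_iff (hw i).le (by positivity) (by positivity)).1 h2
    linarith
  have hlim : Tendsto (fun n => 1 / ((g n).1.den : ℝ) ^ τ) atTop (𝓝 0) := by
    have h := ((tendsto_rpow_neg_atTop hτ0).comp tendsto_natCast_atTop_atTop).comp
      hmono.tendsto_atTop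
    refine h.congr fun n => ?_
    simp [Real.rpow_neg (hpos (g n).1).le]
  exact (hw i).not_ge (ge_of_tendsto' hlim hwi)

theorem ofReal_rpow_le_hausdorffMeasure_Aset_inter {τ : ℝ} (hτ : 2 < τ) {x ℓ : ℝ} (hℓ : 0 < ℓ) :
    ENNReal.ofReal ((ℓ / 50) ^ (2 / τ)) ≤ μH[2 / τ] (Aset τ ∩ closedBall x ℓ) := by
  have hs0 : 0 < 2 / τ := by
    have : 0 < τ := by linarith
    positivity
  rw [Measure.hausdorffMeasure_apply]
  refine le_iSup₂_of_le (1 : ℝ≥0∞) one_pos (le_iInf₂ fun U hU => le_iInf fun hdiam => ?_)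
  refine ENNReal.le_of_forall_pos_le_add fun ε hε _ => ?_
  obtain ⟨ε', hε'0, hε'⟩ :=
    ENNReal.exists_pos_sum_of_countable (ENNReal.coe_pos.2 hε).ne' ℕ
  have hfin : ∀ i, ediam (U i) ≠ ∞ := fun i => ne_top_of_le_ne_top ENNReal.one_ne_top (hdiam i)
  let D : ℕ → ℝ := fun i => (ediam (U i)).toReal ^ (2 / τ) + ε' i
  have hD : ∀ i, (ediam (U i)).toReal ^ (2 / τ) < D i := fun i =>
    lt_add_of_pos_right _ (NNReal.coe_pos.2 (hε'0 i))
  have hD0 : ∀ i, 0 < D i := fun i => lt_of_le_of_lt (by positivity) (hD i)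
  have hDw : ∀ i, (D i ^ (2 / τ)⁻¹) ^ (2 / τ) = D i := fun i =>
    Real.rpow_inv_rpow (hD0 i).le hs0.ne'
  have hmain := ofReal_rpow_le_tsum_of_Aset_inter_subset hτ (U := U)
    (w := fun i => D i ^ (2 / τ)⁻¹) (fun i => Real.rpow_pos_of_pos (hD0 i) _)
    (fun i y hy z hz => by
      have h1 : dist y z ≤ (ediam (U i)).toReal := by
        rw [dist_edist]
        exact ENNReal.toReal_mono (hfin i) (edist_le_ediam_of_mem hy hz)
      refine h1.trans ((Real.le_rpow_inv_iff_of_pos (by positivity) (hD0 i).le hs0).2 (hD i).le))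
    hℓ hU
  refine hmain.trans ?_
  calc ∑' i, ENNReal.ofReal ((D i ^ (2 / τ)⁻¹) ^ (2 / τ))
      ≤ ∑' i, ((⨆ _ : (U i).Nonempty, ediam (U i) ^ (2 / τ)) + ε' i) := by
        refine ENNReal.tsum_le_tsum fun i => ?_
        rw [hDw, ENNReal.ofReal_add (by positivity) (by positivity), ENNReal.ofReal_coe_nnreal,
          ← ENNReal.ofReal_rpow_of_nonneg ENNReal.toReal_nonneg hs0.le,
          ENNReal.ofReal_toReal (hfin i)]
        gcongr
        rcases (U i).eq_empty_or_nonempty with h | h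
        · simp [h, hs0]
        · exact le_iSup_of_le h le_rfl
    _ = _ := ENNReal.tsum_add
    _ ≤ _ := by gcongr

theorem hausdorffMeasure_Aset_eq_top {τ : ℝ} (hτ : 2 ≤ τ) : μH[2 / τ] (Aset τ) = ∞ := by
  rcases hτ.eq_or_lt with rfl | hτ
  · have hirr : {y : ℝ | Irrational y} ⊆ Aset 2 := fun y hy => ⟨1, one_pos,
      (Real.infinite_rat_abs_sub_lt_one_div_den_sq_of_irrational hy).mono fun r hr => by
        have hr' : |y - (r : ℝ)| < 1 / (r.den : ℝ) ^ 2 := hr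
        rw [← Real.rpow_two] at hr'
        exact hr'.le⟩
    rw [div_self two_ne_zero, hausdorffMeasure_real, ← top_le_iff, ← Real.volume_univ,
      ← measure_sdiff_null ((countable_range ((↑) : ℚ → ℝ)).measure_zero volume)]
    exact measure_mono fun y hy => hirr hy.2
  rw [← top_le_iff]
  have hdisj : Pairwise (Function.onFun Disjoint fun n : ℕ => closedBall (3 * n : ℝ) 1) := by
    intro m n hmn
    refine closedBall_disjoint_closedBall ?_
    have h1 : (1 : ℝ) ≤ dist (m : ℝ) n := by
      rw [Nat.dist_cast_real]
      exact Nat.pairwise_one_le_dist hmn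
    rw [Real.dist_eq] at h1 ⊢
    rw [← mul_sub, abs_mul, abs_of_pos (by norm_num : (0 : ℝ) < 3)]
    linarith
  calc (⊤ : ℝ≥0∞) = ∑' _ : ℕ, ENNReal.ofReal ((1 / 50) ^ (2 / τ)) := by
        rw [ENNReal.tsum_const_eq_top_of_ne_zero]
        exact (ENNReal.ofReal_pos.2 (by positivity)).ne'
    _ ≤ ∑' n : ℕ, (μH[2 / τ]).restrict (Aset τ) (closedBall (3 * n : ℝ) 1) := by
        refine ENNReal.tsum_le_tsum fun n => ?_
        rw [Measure.restrict_apply measurableSet_closedBall, inter_comm]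
        exact ofReal_rpow_le_hausdorffMeasure_Aset_inter hτ one_pos
    _ ≤ (μH[2 / τ]).restrict (Aset τ) univ :=
        (tsum_meas_le_meas_iUnion_of_disjoint _ (fun _ => measurableSet_closedBall) hdisj).trans
          (measure_mono (subset_univ _))
    _ = μH[2 / τ] (Aset τ) := Measure.restrict_apply_univ _

theorem stmt7 (τ : ℝ) (hτ : 2 ≤ τ) :
    dimH (Aset τ) = ENNReal.ofReal (2 / τ) ∧ μH[(2 / τ)] (Aset τ) = ⊤ := by
  have hτ0 : 0 < τ := by linarith
  have htop := hausdorffMeasure_Aset_eq_top hτ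
  refine ⟨le_antisymm (dimH_Aset_le hτ0) ?_, htop⟩
  refine le_dimH_of_hausdorffMeasure_eq_top (d := (2 / τ).toNNReal) ?_
  rwa [Real.coe_toNNReal _ (by positivity)]
end

section
/- Let α > r > 0 with α − r ∉ ℤ and define g(x) = ∫_0^{2i} z^{α−1}/(x+z)^r dz for x > 0 (integral along the vertical segment from 0 to 2i, principal branch of powers). Then g(x) = A' x^{α−r} + h(x) where h extends to a function given by a power series converging in a neighborhood of 0, and A' = ∫_0^∞ t^{α−1} ( (1+t)^{−r} − Σ_{0 ≤ k < α−r} C(−r,k) t^{−r−k} ) dt is a nonzero real constant. -/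
open Complex MeasureTheory Real Set

/-- Generalized binomial coefficient `binom(-r, k)` as a real number. -/
noncomputable def genBinom (r : ℝ) (k : ℕ) : ℝ :=
  (∏ i ∈ Finset.range k, (-r - (i : ℝ))) / (Nat.factorial k : ℝ)

/-- `g(x) = ∫_0^{2i} z^{α-1}/(x+z)^r dz` along the vertical segment `z = it`. -/
noncomputable def gInt (α r : ℝ) (x : ℝ) : ℂ :=
  ∫ t in (0:ℝ)..2, ((t : ℂ) * I) ^ ((α : ℂ) - 1) / ((x : ℂ) + t * I) ^ (r : ℂ) * I

lemma genBinom_zero (r : ℝ) : genBinom r 0 = 1 := by simp [genBinom]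

lemma succ_mul_genBinom_succ (r : ℝ) (k : ℕ) :
    ((k : ℝ) + 1) * genBinom r (k + 1) = -r * genBinom (r + 1) k := by
  have h1 : ((k.factorial : ℕ) : ℝ) ≠ 0 := by positivity
  have h2 : (k : ℝ) + 1 ≠ 0 := by positivity
  have h3 : ∏ i ∈ Finset.range k, (-r - ((i + 1 : ℕ) : ℝ))
      = ∏ i ∈ Finset.range k, (-(r + 1) - (i : ℝ)) :=
    Finset.prod_congr rfl fun i _ => by push_cast; ring
  rw [genBinom, genBinom, Finset.prod_range_succ', h3, Nat.factorial_succ]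
  push_cast
  field_simp
  ring

lemma genBinom_eq_choose (r : ℝ) (k : ℕ) : genBinom r k = Ring.choose (-r) k := by
  have h1 : ((k.factorial : ℕ) : ℝ) ≠ 0 := by positivity
  have h2 : ∀ n : ℕ, (descPochhammer ℤ n).smeval (-r) = ∏ i ∈ Finset.range n, (-r - (i : ℝ)) := by
    intro n
    induction n with
    | zero => simp
    | succ n ih =>
      rw [descPochhammer_succ_right, Polynomial.smeval_mul, ih, Finset.prod_range_succ,
        Polynomial.smeval_sub, Polynomial.smeval_X, Polynomial.smeval_natCast]
      simp
  have h3 := Ring.descPochhammer_eq_factorial_smul_choose (-r) k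
  rw [h2, nsmul_eq_mul] at h3
  rw [genBinom, h3]
  field_simp

/-- The Taylor remainder of order `N` of `ξ ↦ (1 + ξ) ^ (-r)` at `0`. -/
noncomputable def binomRemainder (r : ℝ) (N : ℕ) (ξ : ℝ) : ℝ :=
  (1 + ξ) ^ (-r) - ∑ k ∈ Finset.range N, genBinom r k * ξ ^ k

lemma hasDerivAt_binomRemainder_succ (r : ℝ) (N : ℕ) {ξ : ℝ} (hξ : 0 ≤ ξ) :
    HasDerivAt (binomRemainder r (N + 1)) (-r * binomRemainder (r + 1) N ξ) ξ := by
  have h1 : HasDerivAt (fun ξ : ℝ => (1 + ξ) ^ (-r)) (1 * (-r) * (1 + ξ) ^ (-r - 1)) ξ :=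
    ((hasDerivAt_id ξ).const_add 1).rpow_const (Or.inl (by simp; linarith))
  have h2 : HasDerivAt (fun ξ : ℝ => ∑ k ∈ Finset.range (N + 1), genBinom r k * ξ ^ k)
      (∑ k ∈ Finset.range (N + 1), genBinom r k * (k * ξ ^ (k - 1))) ξ :=
    HasDerivAt.fun_sum fun k _ => (hasDerivAt_pow k ξ).const_mul _
  refine (h1.sub h2).congr_deriv ?_
  rw [binomRemainder, Finset.sum_range_succ', mul_sub, Finset.mul_sum]
  have h3 : ∀ k, genBinom r (k + 1) * (((k + 1 : ℕ) : ℝ) * ξ ^ (k + 1 - 1))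
      = -r * (genBinom (r + 1) k * ξ ^ k) := by
    intro k
    rw [Nat.add_sub_cancel, ← mul_assoc (-r), ← succ_mul_genBinom_succ]
    push_cast
    ring
  simp only [h3]
  rw [show -(r + 1) = -r - 1 by ring]
  simp

lemma neg_one_pow_mul_binomRemainder_pos (N : ℕ) :
    ∀ {r ξ : ℝ}, 0 < r → 0 < ξ → 0 < (-1) ^ N * binomRemainder r N ξ := by
  induction N with
  | zero =>
    intro r ξ _ hξ
    simp only [binomRemainder, pow_zero, Finset.range_zero, Finset.sum_empty, sub_zero, one_mul]
    exact Real.rpow_pos_of_pos (by linarith) _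
  | succ N ih =>
    intro r ξ hr hξ
    have hd : ∀ y : ℝ, 0 ≤ y → HasDerivAt (fun y => (-1) ^ (N + 1) * binomRemainder r (N + 1) y)
        (r * ((-1) ^ N * binomRemainder (r + 1) N y)) y := fun y hy =>
      ((hasDerivAt_binomRemainder_succ r N hy).const_mul _).congr_deriv (by ring)
    have hmono : StrictMonoOn (fun y => (-1) ^ (N + 1) * binomRemainder r (N + 1) y) (Ici 0) := by
      refine strictMonoOn_of_deriv_pos (convex_Ici 0)
        (fun y hy => (hd y hy).continuousAt.continuousWithinAt) fun y hy => ?_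
      rw [interior_Ici, mem_Ioi] at hy
      rw [(hd y hy.le).deriv]
      exact mul_pos hr (ih (by linarith) hy)
    have h0 : binomRemainder r (N + 1) 0 = 0 := by
      simp [binomRemainder, Finset.sum_range_succ', genBinom_zero]
    have := hmono (mem_Ici.2 le_rfl) (mem_Ici.2 hξ.le) hξ
    simpa only [h0, mul_zero] using this

lemma abs_binomRemainder_le {r ξ : ℝ} (N : ℕ) (hr : 0 < r) (hξ : 0 < ξ) :
    |binomRemainder r N ξ| ≤ |genBinom r N| * ξ ^ N := by
  have h1 := neg_one_pow_mul_binomRemainder_pos N hr hξ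
  have h2 := neg_one_pow_mul_binomRemainder_pos (N + 1) hr hξ
  have h3 : binomRemainder r (N + 1) ξ = binomRemainder r N ξ - genBinom r N * ξ ^ N := by
    rw [binomRemainder, binomRemainder, Finset.sum_range_succ]; ring
  rw [h3, pow_succ] at h2
  have h4 : |(-1) ^ N * binomRemainder r N ξ| ≤ |(-1) ^ N * (genBinom r N * ξ ^ N)| :=
    abs_le_abs_of_nonneg h1.le (by linarith)
  simpa [abs_mul, abs_of_pos hξ] using h4

lemma rpow_mul_sub_eq_binomRemainder (α r : ℝ) (N : ℕ) {t : ℝ} (ht : 0 < t) :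
    t ^ (α - 1) * ((1 + t) ^ (-r) - ∑ k ∈ Finset.range N, genBinom r k * t ^ (-r - (k : ℝ)))
      = t ^ (α - r - 1) * binomRemainder r N t⁻¹ := by
  have h1 : (1 + t) ^ (-r) = t ^ (-r) * (1 + t⁻¹) ^ (-r) := by
    rw [← Real.mul_rpow ht.le (by positivity)]
    congr 1
    field_simp
    ring
  have h2 : ∀ k : ℕ, t ^ (-r - (k : ℝ)) = t ^ (-r) * t⁻¹ ^ k := by
    intro k
    rw [Real.rpow_sub ht, Real.rpow_natCast, inv_pow, div_eq_mul_inv]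
  rw [binomRemainder, h1, show α - r - 1 = (α - 1) + -r by ring, Real.rpow_add ht, mul_assoc,
    mul_sub (t ^ (-r)), Finset.mul_sum]
  congr 2
  exact Finset.sum_congr rfl fun k _ => by rw [h2]; ring

lemma one_add_rpow_neg_le_one {r t : ℝ} (hr : 0 < r) (ht : 0 ≤ t) : (1 + t) ^ (-r) ≤ 1 :=
  Real.rpow_le_one_of_one_le_of_nonpos (by linarith) (by linarith)

lemma integrableOn_Ioc_rpow_mul_one_add_rpow {α r : ℝ} (hr : 0 < r) (hα : 0 < α) (T : ℝ) :
    IntegrableOn (fun t : ℝ => t ^ (α - 1) * (1 + t) ^ (-r)) (Ioc 0 T) := by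
  have h1 : IntegrableOn (fun t : ℝ => t ^ (α - 1)) (Ioc 0 T) :=
    (intervalIntegral.intervalIntegrable_rpow' (a := 0) (b := T) (r := α - 1) (by linarith)).1
  refine Integrable.mono' h1 ?_ ?_
  · exact (Measurable.mul (by fun_prop) (by fun_prop)).aestronglyMeasurable
  · filter_upwards [ae_restrict_mem measurableSet_Ioc] with t ht
    rw [Real.norm_eq_abs, abs_of_nonneg (by have := ht.1; positivity)]
    have := one_add_rpow_neg_le_one hr ht.1.le
    exact mul_le_of_le_one_right (Real.rpow_nonneg ht.1.le _) this

lemma integrableOn_Ioc_subtracted {α r : ℝ} (hr : 0 < r) (hα : 0 < α) {N : ℕ}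
    (hN : ∀ k < N, (k : ℝ) < α - r) (T : ℝ) :
    IntegrableOn (fun t : ℝ => t ^ (α - 1) *
      ((1 + t) ^ (-r) - ∑ k ∈ Finset.range N, genBinom r k * t ^ (-r - (k : ℝ)))) (Ioc 0 T) := by
  have h2 : IntegrableOn (fun t : ℝ => ∑ k ∈ Finset.range N,
      genBinom r k * t ^ (α - r - k - 1)) (Ioc 0 T) := by
    refine integrable_finsetSum _ fun k hk => Integrable.const_mul ?_ _
    have := hN k (Finset.mem_range.1 hk)
    exact (intervalIntegral.intervalIntegrable_rpow' (a := 0) (b := T) (by linarith)).1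
  refine ((integrableOn_Ioc_rpow_mul_one_add_rpow hr hα T).sub h2).congr_fun_ae ?_
  filter_upwards [ae_restrict_mem measurableSet_Ioc] with t ht
  simp only [Pi.sub_apply, mul_sub, Finset.mul_sum]
  congr 1
  refine Finset.sum_congr rfl fun k _ => ?_
  rw [mul_left_comm, ← Real.rpow_add ht.1]
  ring_nf

lemma integrableOn_Ioi_subtracted {α r : ℝ} (hr : 0 < r) (hα : 0 < α) {N : ℕ}
    (hN : ∀ k < N, (k : ℝ) < α - r) (hN' : α - r < N) :
    IntegrableOn (fun t : ℝ => t ^ (α - 1) *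
      ((1 + t) ^ (-r) - ∑ k ∈ Finset.range N, genBinom r k * t ^ (-r - (k : ℝ)))) (Ioi 0) := by
  rw [← Ioc_union_Ioi_eq_Ioi zero_le_one, integrableOn_union]
  refine ⟨integrableOn_Ioc_subtracted hr hα hN 1, ?_⟩
  have h1 : IntegrableOn (fun t : ℝ => |genBinom r N| * t ^ (α - r - 1 - N)) (Ioi 1) :=
    (integrableOn_Ioi_rpow_of_lt (by linarith) one_pos).const_mul _
  refine Integrable.mono' h1 ?_ ?_
  · refine (Measurable.mul (by fun_prop) (Measurable.sub (by fun_prop) ?_)).aestronglyMeasurable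
    exact Finset.measurable_fun_sum _ fun k _ => by fun_prop
  · filter_upwards [ae_restrict_mem measurableSet_Ioi] with t ht
    have ht0 : (0 : ℝ) < t := one_pos.trans ht
    rw [rpow_mul_sub_eq_binomRemainder α r N ht0, Real.norm_eq_abs, abs_mul,
      abs_of_pos (Real.rpow_pos_of_pos ht0 _), Real.rpow_sub ht0 _ (N : ℝ), Real.rpow_natCast,
      div_eq_mul_inv, ← inv_pow, mul_left_comm]
    exact mul_le_mul_of_nonneg_left (abs_binomRemainder_le N hr (inv_pos.2 ht0))
      (Real.rpow_nonneg ht0.le _)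

lemma integral_subtracted_ne_zero {α r : ℝ} (hr : 0 < r) (hα : 0 < α) {N : ℕ}
    (hN : ∀ k < N, (k : ℝ) < α - r) (hN' : α - r < N) :
    (∫ t in Ioi (0:ℝ), t ^ (α - 1) *
        ((1 + t) ^ (-r) - ∑ k ∈ Finset.range N, genBinom r k * t ^ (-r - (k : ℝ)))) ≠ 0 := by
  have hint := (integrableOn_Ioi_subtracted hr hα hN hN').const_mul ((-1) ^ N)
  have hpos : ∀ t ∈ Ioi (0:ℝ), 0 < (-1) ^ N * (t ^ (α - 1) *
      ((1 + t) ^ (-r) - ∑ k ∈ Finset.range N, genBinom r k * t ^ (-r - (k : ℝ)))) := by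
    intro t ht
    rw [rpow_mul_sub_eq_binomRemainder α r N ht, mul_left_comm]
    exact mul_pos (Real.rpow_pos_of_pos ht _)
      (neg_one_pow_mul_binomRemainder_pos N hr (inv_pos.2 ht))
  have h := (setIntegral_pos_iff_support_of_nonneg_ae
    (by filter_upwards [ae_restrict_mem measurableSet_Ioi] with t ht using (hpos t ht).le) hint).2
    (by
      rw [inter_eq_self_of_subset_right fun t ht => Function.mem_support.2 (hpos t ht).ne',
        Real.volume_Ioi]
      exact ENNReal.zero_lt_top)
  rw [integral_const_mul] at h
  exact right_ne_zero_of_mul h.ne'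

lemma hasSum_genBinom_mul_pow (r : ℝ) {u : ℂ} (hu : ‖u‖ < 1) :
    HasSum (fun k : ℕ => (genBinom r k : ℂ) * u ^ k) ((1 + u) ^ (-(r : ℂ))) := by
  have h := (Complex.one_add_cpow_hasFPowerSeriesOnBall_zero (a := -(r : ℂ))).hasSum
    (y := u) (by simpa [Metric.mem_eball, edist_zero_right, ← ofReal_norm] using hu)
  rw [zero_add] at h
  refine h.congr_fun fun k => ?_
  rw [binomialSeries_apply, genBinom_eq_choose, Complex.ofReal_choose]
  simp

lemma summable_abs_genBinom_mul_pow (r : ℝ) {ρ : ℝ} (hρ : 0 ≤ ρ) (hρ' : ρ < 1) :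
    Summable fun k : ℕ => |genBinom r k| * ρ ^ k := by
  have h := (hasSum_genBinom_mul_pow r (u := (ρ : ℂ)) (by simpa [abs_of_nonneg hρ])).summable.norm
  simpa [abs_of_nonneg hρ] using h

/-- The power series solution `q` of `β q(u) - u q'(u) = (1 + u) ^ (-r)`. -/
noncomputable def eulerSeries (β r : ℝ) (u : ℂ) : ℂ :=
  ∑' k : ℕ, (genBinom r k : ℂ) / ((β : ℂ) - k) * u ^ k

lemma exists_pos_le_norm_sub_nat {β : ℝ} (hβ : ∀ n : ℤ, β ≠ n) :
    ∃ d > 0, ∀ k : ℕ, d ≤ ‖(β : ℂ) - k‖ := by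
  refine ⟨|β - round β|, abs_pos.2 (sub_ne_zero.2 (hβ _)), fun k => ?_⟩
  have h := round_le β (k : ℤ)
  rw [show (β : ℂ) - k = ((β - k : ℝ) : ℂ) by push_cast; rfl, Complex.norm_real, Real.norm_eq_abs]
  simpa using h

lemma norm_eulerCoeff_le {β d : ℝ} (r : ℝ) (hd : 0 < d) (h : ∀ k : ℕ, d ≤ ‖(β : ℂ) - k‖) (k : ℕ) :
    ‖(genBinom r k : ℂ) / ((β : ℂ) - k)‖ ≤ d⁻¹ * |genBinom r k| := by
  rw [norm_div, Complex.norm_real, Real.norm_eq_abs, div_eq_inv_mul]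
  exact mul_le_mul_of_nonneg_right (inv_anti₀ hd (h k)) (abs_nonneg _)

lemma summable_norm_eulerCoeff_mul_pow {β : ℝ} (r : ℝ) (hβ : ∀ n : ℤ, β ≠ n) {ρ : ℝ} (hρ : 0 ≤ ρ)
    (hρ' : ρ < 1) : Summable fun k : ℕ => ‖(genBinom r k : ℂ) / ((β : ℂ) - k)‖ * ρ ^ k := by
  obtain ⟨d, hd, h⟩ := exists_pos_le_norm_sub_nat hβ
  refine Summable.of_nonneg_of_le (fun k => by positivity) (fun k => ?_)
    ((summable_abs_genBinom_mul_pow r hρ hρ').mul_left d⁻¹)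
  rw [← mul_assoc]
  exact mul_le_mul_of_nonneg_right (norm_eulerCoeff_le r hd h k) (by positivity)

lemma exists_hasDerivAt_eulerSeries {β : ℝ} (r : ℝ) (hβ : ∀ n : ℤ, β ≠ n) {u : ℂ} (hu : ‖u‖ < 1) :
    ∃ q', HasDerivAt (eulerSeries β r) q' u ∧
      β * eulerSeries β r u - u * q' = (1 + u) ^ (-(r : ℂ)) := by
  obtain ⟨d, hd, hd'⟩ := exists_pos_le_norm_sub_nat hβ
  obtain ⟨ρ, huρ, hρ⟩ := exists_between hu
  have hρ0 : 0 < ρ := (norm_nonneg u).trans_lt huρ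
  have hne : ∀ k : ℕ, (β : ℂ) - k ≠ 0 := fun k => norm_pos_iff.1 (hd.trans_le (hd' k))
  set c : ℕ → ℂ := fun k => (genBinom r k : ℂ) / ((β : ℂ) - k) with hc
  have hkc : ∀ k : ℕ, (k : ℂ) * c k = β * c k - genBinom r k := by
    intro k
    have := hne k
    simp only [hc]
    field_simp
    ring
  have hbound : Summable fun k : ℕ => (|β| * (‖c k‖ * ρ ^ k) + |genBinom r k| * ρ ^ k) * ρ⁻¹ :=
    (((summable_norm_eulerCoeff_mul_pow r hβ hρ0.le hρ).mul_left _).add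
      (summable_abs_genBinom_mul_pow r hρ0.le hρ)).mul_right _
  have hderiv := hasDerivAt_tsum_of_isPreconnected (g := fun k z => c k * z ^ k)
    (g' := fun k z => c k * (k * z ^ (k - 1))) (t := Metric.ball 0 ρ) (y₀ := 0) (y := u)
    hbound Metric.isOpen_ball (convex_ball 0 ρ).isPreconnected
    (fun k z _ => (hasDerivAt_pow k z).const_mul _) ?_ (by simpa using hρ0) ?_ (by simpa using huρ)
  · refine ⟨_, hderiv, ?_⟩
    have h1 : Summable fun k => c k * u ^ k := by
      refine Summable.of_norm ?_
      simpa [hc] using summable_norm_eulerCoeff_mul_pow r hβ (norm_nonneg u) hu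
    have h2 := (h1.hasSum.mul_left (β : ℂ)).sub (hasSum_genBinom_mul_pow r hu)
    have h3 : u * ∑' k, c k * (k * u ^ (k - 1))
        = ∑' k, (β * (c k * u ^ k) - genBinom r k * u ^ k) := by
      rw [← tsum_mul_left]
      congr 1
      ext k
      rw [show β * (c k * u ^ k) - genBinom r k * u ^ k = k * c k * u ^ k by rw [hkc]; ring]
      rcases k with _ | k
      · simp
      · rw [Nat.add_sub_cancel, pow_succ]; ring
    rw [h3, h2.tsum_eq, eulerSeries]
    ring
  · intro k z hz
    have hz' : ‖z‖ ≤ ρ := by simpa using (mem_ball_zero_iff.1 hz).le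
    rcases k with _ | k
    · simp only [Nat.cast_zero, zero_mul, mul_zero, norm_zero]; positivity
    · have h1 : c (k + 1) * (((k + 1 : ℕ) : ℂ) * z ^ (k + 1 - 1))
          = (β * c (k + 1) - genBinom r (k + 1)) * z ^ k := by
        rw [← hkc, Nat.add_sub_cancel]; ring
      have h2 : ‖(β : ℂ) * c (k + 1) - genBinom r (k + 1)‖
          ≤ |β| * ‖c (k + 1)‖ + |genBinom r (k + 1)| := by
        refine (norm_sub_le _ _).trans (le_of_eq ?_)
        simp
      rw [h1, norm_mul, norm_pow]
      calc _ ≤ (|β| * ‖c (k + 1)‖ + |genBinom r (k + 1)|) * ρ ^ k := by gcongr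
        _ = _ := by rw [pow_succ]; field_simp
  · refine summable_of_ne_finset_zero (s := {0}) fun k hk => ?_
    simp [Finset.notMem_singleton.1 hk]

lemma exists_norm_eulerSeries_sub_sum_le {β : ℝ} (r : ℝ) (hβ : ∀ n : ℤ, β ≠ n) (N : ℕ) :
    ∃ C : ℝ, ∀ u : ℂ, ‖u‖ ≤ 1 / 2 → ‖eulerSeries β r u -
      ∑ k ∈ Finset.range N, (genBinom r k : ℂ) / ((β : ℂ) - k) * u ^ k‖ ≤ C * ‖u‖ ^ N := by
  have hs := summable_norm_eulerCoeff_mul_pow r hβ (ρ := 1 / 2) (by norm_num) (by norm_num)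
  refine ⟨2 ^ N * ∑' k : ℕ, ‖(genBinom r (k + N) : ℂ) / ((β : ℂ) - (k + N : ℕ))‖
    * (1 / 2) ^ (k + N), fun u hu => ?_⟩
  have h1 : Summable fun k : ℕ => (genBinom r k : ℂ) / ((β : ℂ) - k) * u ^ k := by
    refine Summable.of_norm ?_
    simpa using summable_norm_eulerCoeff_mul_pow r hβ (norm_nonneg u) (by linarith)
  rw [eulerSeries, ← h1.sum_add_tsum_nat_add N, add_sub_cancel_left]
  refine tsum_of_norm_bounded
    ((((summable_nat_add_iff N).2 hs).hasSum.mul_left (2 ^ N)).mul_right (‖u‖ ^ N)) fun k => ?_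
  rw [norm_mul, norm_pow, pow_add, pow_add]
  have h2 : ‖u‖ ^ k ≤ (1 / 2) ^ k := pow_le_pow_left₀ (norm_nonneg u) hu k
  calc _ ≤ ‖(genBinom r (k + N) : ℂ) / ((β : ℂ) - (k + N : ℕ))‖ * ((1 / 2) ^ k * ‖u‖ ^ N) := by
        gcongr
    _ = _ := by
      have : (2 : ℝ) ^ N * (1 / 2) ^ N = 1 := by rw [← mul_pow]; norm_num
      linear_combination (-‖(genBinom r (k + N) : ℂ) / ((β : ℂ) - (k + N : ℕ))‖
        * ((1 / 2) ^ k * ‖u‖ ^ N)) * this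

lemma analyticAt_eulerSeries_zero {β : ℝ} (r : ℝ) (hβ : ∀ n : ℤ, β ≠ n) :
    AnalyticAt ℂ (eulerSeries β r) 0 := by
  refine DifferentiableOn.analyticAt (s := Metric.ball 0 1) (fun u hu => ?_)
    (Metric.ball_mem_nhds 0 one_pos)
  obtain ⟨q', hq, -⟩ := exists_hasDerivAt_eulerSeries r hβ (mem_ball_zero_iff.1 hu)
  exact hq.differentiableAt.differentiableWithinAt

/-- The integrand `z ^ (α - 1) * (1 + z) ^ (-r) dz` in the logarithmic coordinate `z = exp w`. -/
noncomputable def logIntegrand (α r : ℝ) (w : ℂ) : ℂ :=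
  Complex.exp (α * w) * (1 + Complex.exp w) ^ (-(r : ℂ))

lemma exp_re_nonneg_of_abs_im_le {w : ℂ} (hw : |w.im| ≤ π / 2) : 0 ≤ (Complex.exp w).re := by
  rw [Complex.exp_re]
  exact mul_nonneg (Real.exp_pos _).le (Real.cos_nonneg_of_mem_Icc (abs_le.1 hw))

lemma one_add_exp_re_pos {w : ℂ} (hw : |w.im| ≤ π / 2) : 0 < (1 + Complex.exp w).re := by
  have := exp_re_nonneg_of_abs_im_le hw
  rw [Complex.add_re, Complex.one_re]
  linarith

lemma differentiableAt_logIntegrand (α r : ℝ) {w : ℂ} (hw : |w.im| ≤ π / 2) :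
    DifferentiableAt ℂ (logIntegrand α r) w := by
  have h : 1 + Complex.exp w ∈ slitPlane := Or.inl (one_add_exp_re_pos hw)
  unfold logIntegrand
  exact (by fun_prop : DifferentiableAt ℂ (fun w => Complex.exp (α * w)) w).mul
    (DifferentiableAt.cpow_const (by fun_prop) h)

lemma norm_logIntegrand_le (α : ℝ) {r : ℝ} (hr : 0 < r) {w : ℂ} (hw : |w.im| ≤ π / 2) :
    ‖logIntegrand α r w‖ ≤ Real.exp (α * w.re) := by
  have h0 := one_add_exp_re_pos hw
  have hne : 1 + Complex.exp w ≠ 0 := fun h => by simp [h] at h0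
  have h1 : 1 ≤ ‖1 + Complex.exp w‖ := by
    refine le_trans ?_ (Complex.re_le_norm _)
    have := exp_re_nonneg_of_abs_im_le hw
    rw [Complex.add_re, Complex.one_re]
    linarith
  rw [logIntegrand, norm_mul, Complex.norm_exp, Complex.norm_cpow_of_ne_zero hne]
  simp only [Complex.re_ofReal_mul, Complex.neg_re, Complex.ofReal_re, Complex.neg_im,
    Complex.ofReal_im, neg_zero, mul_zero, Real.exp_zero, div_one]
  exact mul_le_of_le_one_right (Real.exp_pos _).le
    (Real.rpow_le_one_of_one_le_of_nonpos h1 (by linarith))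

lemma one_add_exp_cpow (s : ℂ) {w : ℂ} (hw : |w.im| ≤ π / 2) :
    (1 + Complex.exp w) ^ s = Complex.exp (s * w) * (1 + Complex.exp (-w)) ^ s := by
  have h0 := one_add_exp_re_pos hw
  have h1 := one_add_exp_re_pos (w := -w) (by simpa using hw)
  have hne : 1 + Complex.exp w ≠ 0 := fun h => by simp [h] at h0
  have hne' : 1 + Complex.exp (-w) ≠ 0 := fun h => by simp [h] at h1
  have harg := abs_lt.1 (Complex.abs_arg_lt_pi_div_two_iff.2 (Or.inl h1))
  have hw' := abs_le.1 hw
  have hlog : Complex.log (1 + Complex.exp w) = w + Complex.log (1 + Complex.exp (-w)) := by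
    rw [← Complex.log_exp (x := w + Complex.log (1 + Complex.exp (-w))), Complex.exp_add,
      Complex.exp_log hne', mul_add, ← Complex.exp_add, add_neg_cancel, Complex.exp_zero, mul_one,
      add_comm]
    · rw [Complex.add_im, Complex.log_im]; linarith [harg.1, hw'.1]
    · rw [Complex.add_im, Complex.log_im]; linarith [harg.2, hw'.2]
  rw [Complex.cpow_def_of_ne_zero hne, Complex.cpow_def_of_ne_zero hne', hlog, ← Complex.exp_add]
  ring_nf

/-- A primitive of `logIntegrand α r` on the right half of the strip `|im w| ≤ π / 2`. -/
noncomputable def logPrimitive (β r : ℝ) (w : ℂ) : ℂ :=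
  Complex.exp (β * w) * eulerSeries β r (Complex.exp (-w))

lemma hasDerivAt_logPrimitive {α r : ℝ} (hβ : ∀ n : ℤ, α - r ≠ n) {w : ℂ} (hw : |w.im| ≤ π / 2)
    (hre : 0 < w.re) : HasDerivAt (logPrimitive (α - r) r) (logIntegrand α r w) w := by
  have hu : ‖Complex.exp (-w)‖ < 1 := by
    simpa [Complex.norm_exp] using hre
  obtain ⟨q', hq, heq⟩ := exists_hasDerivAt_eulerSeries r hβ hu
  have h1 : HasDerivAt (fun w => Complex.exp (-w)) (Complex.exp (-w) * -1) w :=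
    (hasDerivAt_id w).neg.cexp
  have h2 : HasDerivAt (fun w => Complex.exp (((α - r : ℝ) : ℂ) * w))
      (Complex.exp (((α - r : ℝ) : ℂ) * w) * (((α - r : ℝ) : ℂ) * 1)) w :=
    ((hasDerivAt_id w).const_mul _).cexp
  refine (h2.mul (hq.comp w h1)).congr_deriv ?_
  have h3 : Complex.exp (α * w) = Complex.exp (((α - r : ℝ) : ℂ) * w) * Complex.exp (r * w) := by
    rw [← Complex.exp_add]; push_cast; ring_nf
  have h4 : Complex.exp (r * w) * Complex.exp (-r * w) = 1 := by
    rw [← Complex.exp_add]; simp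
  rw [logIntegrand, one_add_exp_cpow _ hw, ← heq, h3]
  simp only [Function.comp_apply]
  linear_combination (-Complex.exp (((α - r : ℝ) : ℂ) * w) * (((α - r : ℝ) : ℂ) *
    eulerSeries (α - r) r (Complex.exp (-w)) - Complex.exp (-w) * q')) * h4

lemma integral_logIntegrand_rect {α r : ℝ} (hβ : ∀ n : ℤ, α - r ≠ n) (a : ℝ) {b : ℝ} (hb : 0 < b) :
    (∫ s in a..b, logIntegrand α r (s + (π / 2 : ℝ) * I)) - ∫ s in a..b, logIntegrand α r s
      = logPrimitive (α - r) r (b + (π / 2 : ℝ) * I) - logPrimitive (α - r) r b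
        - I * ∫ θ in (0 : ℝ)..(π / 2), logIntegrand α r (a + θ * I) := by
  have hstrip : ∀ θ ∈ uIcc 0 (π / 2), |θ| ≤ π / 2 := by
    intro θ hθ
    rw [uIcc_of_le (by positivity)] at hθ
    rw [abs_of_nonneg hθ.1]
    exact hθ.2
  have h := integral_boundary_rect_eq_zero_of_differentiableOn (logIntegrand α r) (a : ℂ)
    ((b : ℂ) + (π / 2 : ℝ) * I) fun w hw =>
      (differentiableAt_logIntegrand α r (hstrip _ (by simpa using hw.2))).differentiableWithinAt
  simp only [ofReal_re, ofReal_im, add_re, add_im, mul_re, mul_im, I_re, I_im, ofReal_zero,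
    zero_mul, add_zero, mul_zero, sub_zero, zero_add, mul_one, smul_eq_mul] at h
  have hderiv : ∀ θ ∈ uIcc 0 (π / 2), HasDerivAt (fun θ : ℝ => logPrimitive (α - r) r (b + θ * I))
      (logIntegrand α r (b + θ * I) * I) θ := by
    intro θ hθ
    have h1 := hasDerivAt_logPrimitive hβ (w := b + θ * I) (by simpa using hstrip θ hθ)
      (by simpa using hb)
    have h2 : HasDerivAt (fun θ : ℝ => (b : ℂ) + θ * I) (1 * I) θ :=
      ((Complex.ofRealCLM.hasDerivAt (x := θ)).mul_const I).const_add _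
    have h3 := h1.comp θ h2
    rw [one_mul] at h3
    exact h3
  have hcont : ContinuousOn (fun θ : ℝ => logIntegrand α r (b + θ * I) * I) (uIcc 0 (π / 2)) := by
    intro θ hθ
    have h1 := (differentiableAt_logIntegrand α r (w := b + θ * I)
      (by simpa using hstrip θ hθ)).continuousAt
    have h2 : ContinuousAt (fun θ : ℝ => (b : ℂ) + θ * I) θ := by fun_prop
    exact ((ContinuousAt.comp (f := fun θ : ℝ => (b : ℂ) + θ * I) h1 h2).mul continuousAt_const).continuousWithinAt
  have hftc := intervalIntegral.integral_eq_sub_of_hasDerivAt hderiv hcont.intervalIntegrable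
  rw [intervalIntegral.integral_mul_const] at hftc
  simp only [ofReal_zero, zero_mul, add_zero] at hftc
  linear_combination -h + hftc

lemma tendsto_integral_logIntegrand_vertical {α r : ℝ} (hr : 0 < r) (hα : 0 < α) :
    Filter.Tendsto (fun a : ℝ => ∫ θ in (0 : ℝ)..(π / 2), logIntegrand α r (a + θ * I))
      Filter.atBot (nhds 0) := by
  have hbound : ∀ a : ℝ, ‖∫ θ in (0 : ℝ)..(π / 2), logIntegrand α r (a + θ * I)‖
      ≤ Real.exp (α * a) * |π / 2 - 0| := by
    intro a
    refine intervalIntegral.norm_integral_le_of_norm_le_const fun θ hθ => ?_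
    rw [uIoc_of_le (by positivity)] at hθ
    refine (norm_logIntegrand_le α hr (w := a + θ * I) ?_).trans (le_of_eq (by simp))
    simpa [abs_of_pos hθ.1] using hθ.2
  refine squeeze_zero_norm hbound ?_
  have h1 : Filter.Tendsto (fun a : ℝ => Real.exp (α * a)) Filter.atBot (nhds 0) :=
    Real.tendsto_exp_atBot.comp (Filter.tendsto_id.const_mul_atBot hα)
  simpa using h1.mul_const (|π / 2 - 0|)

lemma integral_comp_log_sub {F : ℝ → ℂ} (hF : Continuous F) {a b : ℝ} (ha : 0 < a) (hb : 0 < b)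
    (c : ℝ) : ∫ t in a..b, (t⁻¹ : ℝ) • F (Real.log t - c)
      = ∫ s in (Real.log a - c)..(Real.log b - c), F s := by
  have hpos : ∀ t ∈ uIcc a b, t ≠ 0 := fun t ht => ((lt_min ha hb).trans_le ht.1).ne'
  exact intervalIntegral.integral_deriv_smul_comp' (f := fun t => Real.log t - c)
    (fun t ht => (Real.hasDerivAt_log (hpos t ht)).sub_const c)
    (continuousOn_inv₀.mono fun t ht => hpos t ht) hF.continuousOn

lemma continuous_logIntegrand_horizontal (α r : ℝ) {θ : ℝ} (hθ : |θ| ≤ π / 2) :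
    Continuous fun s : ℝ => logIntegrand α r (s + θ * I) := by
  refine continuous_iff_continuousAt.2 fun s => ?_
  have h1 := (differentiableAt_logIntegrand α r (w := s + θ * I) (by simpa using hθ)).continuousAt
  have h2 : ContinuousAt (fun s : ℝ => (s : ℂ) + θ * I) s := by fun_prop
  exact ContinuousAt.comp (f := fun s : ℝ => (s : ℂ) + θ * I) h1 h2

lemma continuous_logIntegrand_ofReal (α r : ℝ) :
    Continuous fun s : ℝ => logIntegrand α r s := by
  simpa using continuous_logIntegrand_horizontal α r (θ := 0) (by simp; positivity)

lemma integral_logIntegrand_ofReal (α r : ℝ) {a b : ℝ} (ha : 0 < a) (hb : 0 < b) :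
    ∫ s in (Real.log a)..(Real.log b), logIntegrand α r s
      = ((∫ t in a..b, t ^ (α - 1) * (1 + t) ^ (-r) : ℝ) : ℂ) := by
  have h := integral_comp_log_sub (continuous_logIntegrand_ofReal α r) ha hb 0
  simp only [sub_zero] at h
  rw [← h, ← intervalIntegral.integral_ofReal]
  refine intervalIntegral.integral_congr fun t ht => ?_
  have ht0 : 0 < t := (lt_min ha hb).trans_le ht.1
  have h1 : Complex.exp (Real.log t) = t := by rw [← Complex.ofReal_exp, Real.exp_log ht0]
  simp only [logIntegrand]
  rw [h1, Real.rpow_sub_one ht0.ne', Real.rpow_def_of_pos ht0]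
  push_cast [Complex.ofReal_cpow (by linarith : 0 ≤ 1 + t)]
  rw [Complex.real_smul]
  push_cast
  ring_nf

lemma smul_logIntegrand_eq {α r x t : ℝ} (hx : 0 < x) (ht : 0 < t) :
    (t⁻¹ : ℝ) • logIntegrand α r ((Real.log t - Real.log x : ℝ) + (π / 2 : ℝ) * I)
      = (x : ℂ) ^ (-((α : ℂ) - r)) *
        (((t : ℂ) * I) ^ ((α : ℂ) - 1) / ((x : ℂ) + t * I) ^ (r : ℂ) * I) := by
  have hxc : (x : ℂ) ≠ 0 := by exact_mod_cast hx.ne'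
  have htc : (t : ℂ) ≠ 0 := by exact_mod_cast ht.ne'
  have hexp : Complex.exp ((Real.log t - Real.log x : ℝ) + (π / 2 : ℝ) * I) = t / x * I := by
    rw [Complex.exp_add, ← Complex.ofReal_exp, Real.exp_sub, Real.exp_log ht, Real.exp_log hx]
    push_cast
    rw [Complex.exp_pi_div_two_mul_I]
  have hne : (1 : ℂ) + t / x * I ≠ 0 := by
    intro h
    have := congrArg Complex.re h
    rw [show (t : ℂ) / x = ((t / x : ℝ) : ℂ) by push_cast; rfl] at this
    simp at this
  have hlogtI : Complex.log (t * I) = Real.log t + π / 2 * I := by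
    rw [Complex.log_ofReal_mul ht I_ne_zero, Complex.log_I]
  have hlogx : Complex.log (x + t * I) = Real.log x + Complex.log (1 + t / x * I) := by
    rw [← Complex.log_ofReal_mul hx hne]
    congr 1
    field_simp
  have hne' : (x : ℂ) + t * I ≠ 0 := by
    intro h
    have := congrArg Complex.re h
    simp at this
    exact hx.ne' this
  have htinv : ((t⁻¹ : ℝ) : ℂ) = Complex.exp (-(Real.log t : ℂ)) := by
    rw [← Complex.ofReal_neg, ← Complex.ofReal_exp, Real.exp_neg, Real.exp_log ht]
  have hI : Complex.exp (π / 2 * I) = I := Complex.exp_pi_div_two_mul_I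
  rw [Complex.real_smul, logIntegrand, hexp,
    div_eq_mul_inv (((t : ℂ) * I) ^ ((α : ℂ) - 1)), ← Complex.cpow_neg,
    Complex.cpow_def_of_ne_zero hne, Complex.cpow_def_of_ne_zero hne',
    Complex.cpow_def_of_ne_zero hxc, Complex.cpow_def_of_ne_zero (mul_ne_zero htc I_ne_zero),
    hlogtI, hlogx, htinv]
  conv_rhs => rw [← hI]
  simp only [← Complex.exp_add]
  rw [← Complex.ofReal_log hx.le]
  congr 1
  rw [hI]
  push_cast
  ring

lemma integral_logIntegrand_pi_div_two {α r x a b : ℝ} (hx : 0 < x) (ha : 0 < a) (hb : 0 < b) :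
    ∫ s in (Real.log (a / x))..(Real.log (b / x)), logIntegrand α r (s + (π / 2 : ℝ) * I)
      = (x : ℂ) ^ (-((α : ℂ) - r)) * ∫ t in a..b,
        ((t : ℂ) * I) ^ ((α : ℂ) - 1) / ((x : ℂ) + t * I) ^ (r : ℂ) * I := by
  rw [Real.log_div ha.ne' hx.ne', Real.log_div hb.ne' hx.ne', ← integral_comp_log_sub
    (continuous_logIntegrand_horizontal α r (le_of_eq (abs_of_pos (by positivity)))) ha hb,
    ← intervalIntegral.integral_const_mul]
  exact intervalIntegral.integral_congr fun t ht =>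
    smul_logIntegrand_eq hx ((lt_min ha hb).trans_le ht.1)

lemma intervalIntegral_subtracted {α r : ℝ} (hr : 0 < r) (hα : 0 < α) {N : ℕ}
    (hN : ∀ k < N, (k : ℝ) < α - r) {T : ℝ} (hT : 0 < T) :
    ∫ t in (0:ℝ)..T, t ^ (α - 1) *
      ((1 + t) ^ (-r) - ∑ k ∈ Finset.range N, genBinom r k * t ^ (-r - (k : ℝ)))
    = (∫ t in (0:ℝ)..T, t ^ (α - 1) * (1 + t) ^ (-r))
      - ∑ k ∈ Finset.range N, genBinom r k / (α - r - k) * T ^ (α - r - k) := by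
  have h1 : ∀ k ∈ Finset.range N, IntervalIntegrable
      (fun t : ℝ => genBinom r k * t ^ (α - r - k - 1)) volume 0 T := fun k hk =>
    (intervalIntegral.intervalIntegrable_rpow'
      (by linarith [hN k (Finset.mem_range.1 hk)])).const_mul _
  have h2 : IntervalIntegrable (fun t : ℝ => t ^ (α - 1) * (1 + t) ^ (-r)) volume 0 T :=
    (intervalIntegrable_iff_integrableOn_Ioc_of_le hT.le).2
      (integrableOn_Ioc_rpow_mul_one_add_rpow hr hα T)
  have h3 : ∑ k ∈ Finset.range N, genBinom r k / (α - r - k) * T ^ (α - r - k)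
      = ∫ t in (0:ℝ)..T, ∑ k ∈ Finset.range N, genBinom r k * t ^ (α - r - k - 1) := by
    rw [intervalIntegral.integral_finsetSum h1]
    refine Finset.sum_congr rfl fun k hk => ?_
    have hk' := hN k (Finset.mem_range.1 hk)
    rw [intervalIntegral.integral_const_mul, integral_rpow (Or.inl (by linarith)),
      sub_add_cancel, Real.zero_rpow (by linarith)]
    ring
  rw [h3, ← intervalIntegral.integral_sub h2 (by
    simpa only [Finset.sum_fn] using IntervalIntegrable.sum _ h1)]
  refine intervalIntegral.integral_congr_ae (ae_of_all _ fun t ht => ?_)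
  rw [uIoc_of_le hT.le] at ht
  rw [mul_sub, Finset.mul_sum]
  congr 1
  refine Finset.sum_congr rfl fun k _ => ?_
  rw [mul_left_comm, ← Real.rpow_add ht.1]
  ring_nf

lemma logPrimitive_log {β r T : ℝ} (hT : 0 < T) :
    logPrimitive β r (Real.log T) = ((T ^ β : ℝ) : ℂ) * eulerSeries β r ((T : ℂ)⁻¹) := by
  rw [logPrimitive, ← Complex.ofReal_neg, ← Complex.ofReal_exp, Real.exp_neg, Real.exp_log hT,
    Real.rpow_def_of_pos hT, mul_comm (Real.log T)]
  push_cast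
  rfl

lemma tendsto_sum_sub_logPrimitive {β : ℝ} (r : ℝ) (hβ : ∀ n : ℤ, β ≠ n) {N : ℕ} (hN : β < N) :
    Filter.Tendsto (fun T : ℝ => logPrimitive β r (Real.log T) -
      ((∑ k ∈ Finset.range N, genBinom r k / (β - k) * T ^ (β - k) : ℝ) : ℂ))
      Filter.atTop (nhds 0) := by
  obtain ⟨C, hC⟩ := exists_norm_eulerSeries_sub_sum_le r hβ N
  have hlim : Filter.Tendsto (fun T : ℝ => C * T ^ (-((N : ℝ) - β))) Filter.atTop (nhds 0) := by
    simpa using (tendsto_rpow_neg_atTop (sub_pos.2 hN)).const_mul C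
  refine squeeze_zero_norm' ?_ hlim
  filter_upwards [Filter.eventually_ge_atTop 2] with T hT
  have hT0 : 0 < T := by linarith
  have hu : ‖(T : ℂ)⁻¹‖ = T⁻¹ := by rw [norm_inv, Complex.norm_real, Real.norm_of_nonneg hT0.le]
  have h1 : ((∑ k ∈ Finset.range N, genBinom r k / (β - k) * T ^ (β - k) : ℝ) : ℂ)
      = ((T ^ β : ℝ) : ℂ) *
        ∑ k ∈ Finset.range N, (genBinom r k : ℂ) / ((β : ℂ) - k) * ((T : ℂ)⁻¹) ^ k := by
    rw [Finset.mul_sum]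
    push_cast
    refine Finset.sum_congr rfl fun k _ => ?_
    rw [Real.rpow_sub hT0, Real.rpow_natCast]
    push_cast
    rw [inv_pow]
    ring
  rw [logPrimitive_log hT0, h1, ← mul_sub, norm_mul, Complex.norm_real,
    Real.norm_of_nonneg (Real.rpow_nonneg hT0.le _)]
  have h2 := hC _ (hu.le.trans (by rw [one_div]; exact inv_anti₀ two_pos hT))
  rw [hu] at h2
  refine (mul_le_mul_of_nonneg_left h2 (Real.rpow_nonneg hT0.le _)).trans (le_of_eq ?_)
  rw [neg_sub, Real.rpow_sub hT0, Real.rpow_natCast, inv_pow]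
  ring

lemma integral_subtracted_eq {α r : ℝ} (hr : 0 < r) (hα : 0 < α) (hβ : ∀ n : ℤ, α - r ≠ n)
    {N : ℕ} (hN : ∀ k < N, (k : ℝ) < α - r) (hN' : α - r < N) {T : ℝ} (hT : 1 < T) :
    ((∫ t in Ioi (0:ℝ), t ^ (α - 1) *
        ((1 + t) ^ (-r) - ∑ k ∈ Finset.range N, genBinom r k * t ^ (-r - (k : ℝ))) : ℝ) : ℂ)
      = ((∫ t in (0:ℝ)..T, t ^ (α - 1) * (1 + t) ^ (-r) : ℝ) : ℂ)
        - logPrimitive (α - r) r (Real.log T) := by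
  have hT0 : 0 < T := one_pos.trans hT
  have h1 := (Complex.continuous_ofReal.tendsto _).comp (intervalIntegral_tendsto_integral_Ioi 0
    (integrableOn_Ioi_subtracted hr hα hN hN') Filter.tendsto_id)
  have h2 := h1.sub (tendsto_sum_sub_logPrimitive r hβ hN')
  rw [sub_zero] at h2
  refine tendsto_nhds_unique h2 (tendsto_const_nhds.congr' ?_)
  filter_upwards [Filter.eventually_gt_atTop 1] with S hS
  have hS0 : 0 < S := one_pos.trans hS
  have hint : ∀ {U : ℝ}, 0 < U →
      IntervalIntegrable (fun t : ℝ => t ^ (α - 1) * (1 + t) ^ (-r)) volume 0 U := fun hU =>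
    (intervalIntegrable_iff_integrableOn_Ioc_of_le hU.le).2
      (integrableOn_Ioc_rpow_mul_one_add_rpow hr hα _)
  have h3 : logPrimitive (α - r) r (Real.log S) - logPrimitive (α - r) r (Real.log T)
      = ((∫ t in T..S, t ^ (α - 1) * (1 + t) ^ (-r) : ℝ) : ℂ) := by
    rw [← integral_logIntegrand_ofReal α r hT0 hS0]
    refine (intervalIntegral.integral_eq_sub_of_hasDerivAt
      (f := fun s : ℝ => logPrimitive (α - r) r s) (fun s hs => ?_)
      (continuous_logIntegrand_ofReal α r).continuousOn.intervalIntegrable).symm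
    have hs0 : 0 < s := (lt_min (Real.log_pos hT) (Real.log_pos hS)).trans_le hs.1
    exact (hasDerivAt_logPrimitive hβ (w := s) (by simp; positivity) (by simpa using hs0)).comp_ofReal
  rw [← intervalIntegral.integral_interval_sub_left (hint hS0) (hint hT0), Complex.ofReal_sub] at h3
  simp only [Function.comp_apply, id, intervalIntegral_subtracted hr hα hN hS0, Complex.ofReal_sub]
  linear_combination h3

lemma tendsto_intervalIntegral_nhdsGT_zero {E : Type*} [NormedAddCommGroup E] [NormedSpace ℝ E]
    {f : ℝ → E} {T : ℝ} (hT : 0 < T) (hf : IntegrableOn f (Ioc 0 T)) :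
    Filter.Tendsto (fun ε => ∫ t in ε..T, f t) (nhdsWithin 0 (Ioi 0))
      (nhds (∫ t in (0:ℝ)..T, f t)) := by
  have h1 : IntegrableOn f (uIcc 0 T) := by
    rwa [uIcc_of_le hT.le, integrableOn_Icc_iff_integrableOn_Ioc]
  have h2 := intervalIntegral.continuousOn_primitive_interval_left h1 0 left_mem_uIcc
  refine h2.mono_left (nhdsWithin_le_iff.2 ?_)
  rw [uIcc_of_le hT.le]
  exact Icc_mem_nhdsGT hT

lemma integrableOn_gInt_integrand {α r x : ℝ} (hr : 0 < r) (hα : 0 < α) (hx : 0 < x) (T : ℝ) :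
    IntegrableOn (fun t : ℝ =>
      ((t : ℂ) * I) ^ ((α : ℂ) - 1) / ((x : ℂ) + t * I) ^ (r : ℂ) * I) (Ioc 0 T) := by
  have h1 : IntegrableOn (fun t : ℝ => t ^ (α - 1)) (Ioc 0 T) :=
    (intervalIntegral.intervalIntegrable_rpow' (a := 0) (b := T) (r := α - 1) (by linarith)).1
  refine Integrable.mono' (h1.div_const (x ^ r)) ?_ ?_
  · exact Measurable.aestronglyMeasurable (by fun_prop)
  · filter_upwards [ae_restrict_mem measurableSet_Ioc] with t ht
    have hx' : x ≤ ‖(x : ℂ) + t * I‖ := by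
      simpa using Complex.re_le_norm ((x : ℂ) + t * I)
    have hne : (x : ℂ) + t * I ≠ 0 := norm_pos_iff.1 (hx.trans_le hx')
    have htI : (t : ℂ) * I ≠ 0 := mul_ne_zero (by exact_mod_cast ht.1.ne') I_ne_zero
    have h2 : ‖((t : ℂ) * I) ^ ((α : ℂ) - 1)‖ = t ^ (α - 1) := by
      rw [show (α : ℂ) - 1 = ((α - 1 : ℝ) : ℂ) by push_cast; rfl, Complex.norm_cpow_of_ne_zero htI]
      simp [abs_of_pos ht.1]
    have h3 : ‖((x : ℂ) + t * I) ^ (r : ℂ)‖ = ‖(x : ℂ) + t * I‖ ^ r := by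
      rw [Complex.norm_cpow_of_ne_zero hne]
      simp
    rw [norm_mul, norm_div, Complex.norm_I, mul_one, h2, h3]
    exact div_le_div_of_nonneg_left (Real.rpow_nonneg ht.1.le _) (Real.rpow_pos_of_pos hx _)
      (Real.rpow_le_rpow hx.le hx' hr.le)

lemma cpow_neg_mul_gInt {α r x : ℝ} (hr : 0 < r) (hα : 0 < α) (hβ : ∀ n : ℤ, α - r ≠ n)
    (hx : 0 < x) (hx2 : x < 2) :
    (x : ℂ) ^ (-((α : ℂ) - r)) * gInt α r x
      = ((∫ t in (0:ℝ)..(2 / x), t ^ (α - 1) * (1 + t) ^ (-r) : ℝ) : ℂ)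
        - logPrimitive (α - r) r (Real.log (2 / x))
        + logPrimitive (α - r) r (Real.log (2 / x) + (π / 2 : ℝ) * I) := by
  have hb : 0 < Real.log (2 / x) := Real.log_pos ((one_lt_div hx).2 hx2)
  have hdiv : Filter.Tendsto (fun ε : ℝ => ε / x) (nhdsWithin 0 (Ioi 0))
      (nhdsWithin 0 (Ioi 0)) := by
    refine tendsto_nhdsWithin_iff.2 ⟨?_, ?_⟩
    · have h : Filter.Tendsto (fun ε : ℝ => ε / x) (nhds 0) (nhds (0 / x)) :=
        Filter.tendsto_id.div_const x
      rw [zero_div] at h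
      exact h.mono_left nhdsWithin_le_nhds
    · filter_upwards [self_mem_nhdsWithin] with ε hε using div_pos hε hx
  have h1 := (tendsto_intervalIntegral_nhdsGT_zero two_pos
    (integrableOn_gInt_integrand hr hα hx 2)).const_mul ((x : ℂ) ^ (-((α : ℂ) - r)))
  have h2 := (Complex.continuous_ofReal.tendsto _).comp
    ((tendsto_intervalIntegral_nhdsGT_zero (div_pos two_pos hx)
      (integrableOn_Ioc_rpow_mul_one_add_rpow hr hα (2 / x))).comp hdiv)
  have h3 := ((tendsto_integral_logIntegrand_vertical hr hα).comp
    (Real.tendsto_log_nhdsGT_zero.comp hdiv)).const_mul I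
  have h4 := (h1.sub h2).add h3
  have h5 := tendsto_nhds_unique h4 (tendsto_const_nhds (x :=
    logPrimitive (α - r) r (Real.log (2 / x) + (π / 2 : ℝ) * I)
      - logPrimitive (α - r) r (Real.log (2 / x))) |>.congr' ?_)
  · rw [gInt]
    linear_combination h5
  · filter_upwards [self_mem_nhdsWithin] with ε hε
    have h6 := integral_logIntegrand_rect hβ (Real.log (ε / x)) hb
    rw [integral_logIntegrand_pi_div_two hx hε two_pos,
      integral_logIntegrand_ofReal α r (div_pos hε hx) (div_pos two_pos hx)] at h6
    simp only [Function.comp_apply]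
    linear_combination -h6

lemma cpow_mul_logPrimitive {β r x : ℝ} (hx : 0 < x) :
    (x : ℂ) ^ (β : ℂ) * logPrimitive β r (Real.log (2 / x) + (π / 2 : ℝ) * I)
      = (2 * I) ^ (β : ℂ) * eulerSeries β r (x / (2 * I)) := by
  have hxc : (x : ℂ) ≠ 0 := by exact_mod_cast hx.ne'
  have h1 : Complex.exp (-(Real.log (2 / x) + (π / 2 : ℝ) * I)) = x / (2 * I) := by
    rw [Complex.exp_neg, Complex.exp_add, ← Complex.ofReal_exp, Real.exp_log (by positivity)]
    push_cast
    rw [Complex.exp_pi_div_two_mul_I]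
    field_simp
  have h2 : Complex.log (2 * I) = Real.log 2 + π / 2 * I := by
    have := Complex.log_ofReal_mul two_pos I_ne_zero
    rwa [Complex.log_I, Complex.ofReal_ofNat] at this
  rw [logPrimitive, h1, ← mul_assoc, Complex.cpow_def_of_ne_zero hxc,
    Complex.cpow_def_of_ne_zero (mul_ne_zero two_ne_zero I_ne_zero), h2, ← Complex.exp_add,
    ← Complex.ofReal_log hx.le, Real.log_div two_ne_zero hx.ne']
  congr 2
  push_cast
  ring

theorem stmt9 (α r : ℝ) (hr : 0 < r) (hαr : r < α) (hnz : ∀ n : ℤ, α - r ≠ (n : ℝ)) :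
    (∫ t in Ioi (0:ℝ), t ^ (α - 1) *
        ((1 + t) ^ (-r) - ∑ k ∈ Finset.range ⌈α - r⌉₊, genBinom r k * t ^ (-r - (k : ℝ)))) ≠ 0 ∧
    ∃ h : ℝ → ℂ, AnalyticAt ℝ h 0 ∧ ∃ δ > (0:ℝ), ∀ x : ℝ, 0 < x → x < δ →
      gInt α r x =
        ((∫ t in Ioi (0:ℝ), t ^ (α - 1) *
          ((1 + t) ^ (-r) - ∑ k ∈ Finset.range ⌈α - r⌉₊, genBinom r k * t ^ (-r - (k : ℝ)))) : ℝ)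
          * (x : ℂ) ^ ((α : ℂ) - (r : ℂ)) + h x := by
  have hα : 0 < α := hr.trans hαr
  have hN : ∀ k < ⌈α - r⌉₊, (k : ℝ) < α - r := fun k hk => Nat.lt_ceil.1 hk
  have hN' : α - r < (⌈α - r⌉₊ : ℝ) :=
    lt_of_le_of_ne (Nat.le_ceil _) (by exact_mod_cast hnz (⌈α - r⌉₊ : ℤ))
  refine ⟨integral_subtracted_ne_zero hr hα hN hN',
    fun x => (2 * I) ^ ((α - r : ℝ) : ℂ) * eulerSeries (α - r) r (x / (2 * I)), ?_, 2, two_pos,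
    fun x hx hx2 => ?_⟩
  · refine analyticAt_const.mul ?_
    have h1 : AnalyticAt ℝ (fun x : ℝ => (x : ℂ) / (2 * I)) 0 :=
      (Complex.ofRealCLM.analyticAt 0).div analyticAt_const (mul_ne_zero two_ne_zero I_ne_zero)
    have h2 : AnalyticAt ℝ (eulerSeries (α - r) r) (((0 : ℝ) : ℂ) / (2 * I)) := by
      simpa using (analyticAt_eulerSeries_zero r hnz).restrictScalars
    exact AnalyticAt.comp (f := fun x : ℝ => (x : ℂ) / (2 * I)) h2 h1
  · have hxc : (x : ℂ) ≠ 0 := by exact_mod_cast hx.ne'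
    have h1 := cpow_neg_mul_gInt hr hα hnz hx hx2
    rw [← integral_subtracted_eq hr hα hnz hN hN' ((one_lt_div hx).2 hx2)] at h1
    have h2 := cpow_mul_logPrimitive (β := α - r) (r := r) hx
    have h3 : (x : ℂ) ^ ((α : ℂ) - r) * (x : ℂ) ^ (-((α : ℂ) - r)) = 1 := by
      rw [← Complex.cpow_add _ _ hxc, add_neg_cancel, Complex.cpow_zero]
    beta_reduce
    rw [← h2, Complex.ofReal_sub]
    linear_combination (x : ℂ) ^ ((α : ℂ) - r) * h1 - gInt α r x * h3
end

section
/- Let g: (0,∞) × ℝ → ℂ be measurable with |∂^k g/∂x^k (a,x)| ≤ C a^{−k−1} for all a > 0, and |∂^k g/∂x^k (a,x)| ≤ C(a^{β−k} + a^{β−β'−k}|x|^{β'}) for a ≤ 1 and |x| ≤ δ, for all 0 ≤ k ≤ N+1, where 0 < β' < β, β ∉ ℤ, N = ⌊β⌋. Then F(x) = ∫_0^∞ g(a,x) da/a is well defined for |x| ≤ δ and there exists a polynomial P of degree ≤ N such that |F(x) − P(x)| ≪ |x|^β as x → 0. -/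
open MeasureTheory Real Set

/-- Taylor's inequality at the origin, on both sides of it. -/
theorem norm_sub_taylor_sum_le {E : Type*} [NormedAddCommGroup E] [NormedSpace ℝ E]
    {f : ℝ → E} {n : ℕ} (hf : ContDiff ℝ (n + 1 : ℕ) f) {x M : ℝ}
    (hM : ∀ y, |y| ≤ |x| → ‖iteratedDeriv (n + 1) f y‖ ≤ M) :
    ‖f x - ∑ k ∈ Finset.range (n + 1), (((k.factorial : ℝ))⁻¹ * x ^ k) • iteratedDeriv k f 0‖
      ≤ M * |x| ^ (n + 1) := by
  have hM0 : 0 ≤ M := (norm_nonneg _).trans (hM x le_rfl)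
  have hF : ContDiff ℝ (n + 1 : ℕ) (fun t : ℝ => f (x * t)) :=
    hf.comp (contDiff_const.mul contDiff_id)
  have hder : ∀ k ≤ n + 1, ∀ t ∈ Icc (0 : ℝ) 1,
      iteratedDerivWithin k (fun t : ℝ => f (x * t)) (Icc 0 1) t
        = x ^ k • iteratedDeriv k f (x * t) := by
    intro k hk t ht
    have hk' : ((k : ℕ) : WithTop ℕ∞) ≤ ((n + 1 : ℕ) : WithTop ℕ∞) := by exact_mod_cast hk
    rw [iteratedDerivWithin_eq_iteratedDeriv (uniqueDiffOn_Icc zero_lt_one)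
      (hF.of_le hk').contDiffAt ht, iteratedDeriv_comp_const_smul (hf.of_le hk')]
  have key := taylor_mean_remainder_bound (f := fun t : ℝ => f (x * t)) (a := 0) (b := 1)
    (C := M * |x| ^ (n + 1)) (x := 1) (n := n) zero_le_one
    (by exact_mod_cast hF.contDiffOn) (by simp) (by
      intro y hy
      rw [hder _ le_rfl y hy, norm_smul, norm_pow, norm_eq_abs, mul_comm]
      gcongr
      apply hM
      rw [abs_mul, abs_of_nonneg hy.1]
      exact mul_le_of_le_one_right (abs_nonneg x) hy.2)
  rw [taylor_within_apply] at key
  have hsum : ∑ k ∈ Finset.range (n + 1), (((k.factorial : ℝ))⁻¹ * (1 - 0) ^ k) •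
        iteratedDerivWithin k (fun t : ℝ => f (x * t)) (Icc 0 1) 0
      = ∑ k ∈ Finset.range (n + 1), (((k.factorial : ℝ))⁻¹ * x ^ k) • iteratedDeriv k f 0 := by
    refine Finset.sum_congr rfl fun k hk => ?_
    rw [hder k (Finset.mem_range.1 hk).le 0 (by simp), smul_smul]
    simp
  rw [hsum, mul_one] at key
  refine key.trans ?_
  rw [sub_zero, one_pow, mul_one]
  exact div_le_self (by positivity) (by exact_mod_cast n.factorial_pos)

/-- Derivatives with respect to a parameter preserve almost everywhere strong measurability. -/
theorem aestronglyMeasurable_iteratedDeriv_param {α E : Type*} [MeasurableSpace α]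
    {μ : Measure α} [NormedAddCommGroup E] [NormedSpace ℝ E] {g : α → ℝ → E} {n : ℕ} {δ : ℝ}
    (hsm : ∀ᵐ a ∂μ, ContDiff ℝ n (g a))
    (hmeas : ∀ x, |x| < δ → AEStronglyMeasurable (fun a => g a x) μ) :
    ∀ k ≤ n, ∀ x, |x| < δ → AEStronglyMeasurable (fun a => iteratedDeriv k (g a) x) μ := by
  intro k
  induction k with
  | zero => simpa using hmeas
  | succ k ih =>
    intro hk x hx
    have hpos : 0 < δ - |x| := sub_pos.2 hx
    set t : ℕ → ℝ := fun m => (δ - |x|) / (m + 2) with ht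
    have ht0 : ∀ m, 0 < t m := fun m => by positivity
    have htlt : ∀ m, t m < δ - |x| := fun m =>
      div_lt_self hpos (by linarith [(Nat.cast_nonneg m : (0 : ℝ) ≤ m)])
    have htlim : Filter.Tendsto t Filter.atTop (nhdsWithin 0 {0}ᶜ) := by
      refine tendsto_nhdsWithin_iff.2 ⟨?_, .of_forall fun m => (ht0 m).ne'⟩
      exact Filter.Tendsto.div_atTop tendsto_const_nhds
        (Filter.tendsto_atTop_add_const_right _ _ tendsto_natCast_atTop_atTop)
    refine aestronglyMeasurable_of_tendsto_ae Filter.atTop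
      (f := fun m a => (t m)⁻¹ • (iteratedDeriv k (g a) (x + t m) - iteratedDeriv k (g a) x))
      (fun m => ?_) ?_
    · refine ((ih (by lia) _ ?_).sub (ih (by lia) x hx)).const_smul _
      calc |x + t m| ≤ |x| + |t m| := abs_add_le _ _
        _ < δ := by rw [abs_of_pos (ht0 m)]; linarith [htlt m]
    · filter_upwards [hsm] with a ha
      have hd : HasDerivAt (iteratedDeriv k (g a)) (iteratedDeriv (k + 1) (g a) x) x := by
        rw [iteratedDeriv_succ]
        exact (ha.differentiable_iteratedDeriv k (by exact_mod_cast hk) x).hasDerivAt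
      exact hd.tendsto_slope_zero.comp htlim

theorem integrableOn_Ioc_zero_rpow {p : ℝ} (hp : -1 < p) {r : ℝ} (hr : 0 ≤ r) :
    IntegrableOn (fun a : ℝ => a ^ p) (Ioc 0 r) :=
  (intervalIntegrable_iff_integrableOn_Ioc_of_le hr).1 (intervalIntegral.intervalIntegrable_rpow' hp)

theorem integral_Ioc_zero_rpow {p : ℝ} (hp : -1 < p) {r : ℝ} (hr : 0 ≤ r) :
    ∫ a in Ioc 0 r, a ^ p = r ^ (p + 1) / (p + 1) := by
  rw [← intervalIntegral.integral_of_le hr, integral_rpow (.inl hp),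
    zero_rpow (by linarith : p + 1 ≠ 0), sub_zero]

/-- Power bounds at the origin and at infinity give integrability on the half-line. -/
theorem integrableOn_Ioi_zero_of_norm_le_rpow {E : Type*} [NormedAddCommGroup E] {f : ℝ → E}
    {A B D p q s : ℝ} (hp : -1 < p) (hq : -1 < q) (hs : s < -1)
    (hf : AEStronglyMeasurable f (volume.restrict (Ioi (0 : ℝ))))
    (h0 : ∀ a, 0 < a → a ≤ 1 → ‖f a‖ ≤ A * a ^ p + B * a ^ q)
    (h1 : ∀ a, 1 < a → ‖f a‖ ≤ D * a ^ s) : IntegrableOn f (Ioi 0) := by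
  rw [← Ioc_union_Ioi_eq_Ioi zero_le_one]
  refine IntegrableOn.union ?_ ?_
  · refine Integrable.mono' (((integrableOn_Ioc_zero_rpow hp zero_le_one).const_mul A).add
      ((integrableOn_Ioc_zero_rpow hq zero_le_one).const_mul B))
      (hf.mono_set Ioc_subset_Ioi_self) ?_
    exact (ae_restrict_iff' measurableSet_Ioc).2 (.of_forall fun a ha => h0 a ha.1 ha.2)
  · refine Integrable.mono' ((integrableOn_Ioi_rpow_of_lt hs zero_lt_one).const_mul D)
      (hf.mono_set (Ioi_subset_Ioi zero_le_one)) ?_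
    exact (ae_restrict_iff' measurableSet_Ioi).2 (.of_forall fun a ha => h1 a ha)

theorem norm_ofReal_inv_mul {a : ℝ} (ha : 0 < a) (z : ℂ) : ‖(a : ℂ)⁻¹ * z‖ = a⁻¹ * ‖z‖ := by
  rw [norm_mul, norm_inv, Complex.norm_real, norm_eq_abs, abs_of_pos ha]

theorem inv_mul_rpow {a : ℝ} (ha : 0 < a) (p : ℝ) : a⁻¹ * a ^ p = a ^ (p - 1) := by
  rw [rpow_sub_one ha.ne', div_eq_inv_mul]

open MeasureTheory Real Set

theorem stmt12 (β β' δ C : ℝ) (hβ' : 0 < β') (hββ' : β' < β) (hβZ : ∀ n : ℤ, β ≠ (n : ℝ))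
    (hδ : 0 < δ) (hC : 0 < C) (N : ℕ) (hN : N = ⌊β⌋₊)
    (g : ℝ → ℝ → ℂ)
    (hsm : ∀ a : ℝ, 0 < a → ContDiff ℝ (N + 1 : ℕ) (g a))
    (hmeas : ∀ x : ℝ, |x| ≤ δ →
      AEStronglyMeasurable (fun a => g a x) (volume.restrict (Ioi (0:ℝ))))
    (h1 : ∀ k : ℕ, k ≤ N + 1 → ∀ a : ℝ, 0 < a → ∀ x : ℝ,
      ‖iteratedDeriv k (g a) x‖ ≤ C * a ^ (-(k : ℝ) - 1))
    (h2 : ∀ k : ℕ, k ≤ N + 1 → ∀ a : ℝ, 0 < a → a ≤ 1 → ∀ x : ℝ, |x| ≤ δ →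
      ‖iteratedDeriv k (g a) x‖ ≤ C * (a ^ (β - k) + a ^ (β - β' - k) * |x| ^ β')) :
    (∀ x : ℝ, |x| ≤ δ → IntegrableOn (fun a : ℝ => (a : ℂ)⁻¹ * g a x) (Ioi (0:ℝ))) ∧
    ∃ P : Polynomial ℂ, P.natDegree ≤ N ∧ ∃ C' > (0:ℝ), ∃ δ' > (0:ℝ), ∀ x : ℝ, |x| < δ' →
      ‖(∫ a in Ioi (0:ℝ), (a : ℂ)⁻¹ * g a x) - P.eval (x : ℂ)‖ ≤ C' * |x| ^ β := by
  have hβ : 0 < β := hβ'.trans hββ'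
  have hNβ : (N : ℝ) < β := by
    refine lt_of_le_of_ne (hN ▸ Nat.floor_le hβ.le) fun h => hβZ N ?_
    rw [← h]; simp
  have hβN : β < N + 1 := hN ▸ Nat.lt_floor_add_one β
  have hinv : AEStronglyMeasurable (fun a : ℝ => (a : ℂ)⁻¹) (volume.restrict (Ioi (0:ℝ))) :=
    (Complex.measurable_ofReal.inv).aestronglyMeasurable
  have hint : ∀ x : ℝ, |x| ≤ δ →
      IntegrableOn (fun a : ℝ => (a : ℂ)⁻¹ * g a x) (Ioi (0:ℝ)) := by
    intro x hx
    refine integrableOn_Ioi_zero_of_norm_le_rpow (A := C) (B := C * |x| ^ β') (D := C)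
      (p := β - 1) (q := β - β' - 1) (s := -2) (by linarith) (by linarith) (by norm_num)
      (hinv.mul (hmeas x hx)) ?_ ?_
    · intro a ha ha1
      rw [norm_ofReal_inv_mul ha, ← inv_mul_rpow ha, ← inv_mul_rpow ha]
      have h := h2 0 (by lia) a ha ha1 x hx
      simp only [iteratedDeriv_zero, Nat.cast_zero, sub_zero] at h
      calc a⁻¹ * ‖g a x‖ ≤ a⁻¹ * (C * (a ^ β + a ^ (β - β') * |x| ^ β')) := by gcongr
        _ = _ := by ring
    · intro a ha
      have ha0 : 0 < a := zero_lt_one.trans ha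
      rw [norm_ofReal_inv_mul ha0, show (-2 : ℝ) = -1 - 1 by norm_num, ← inv_mul_rpow ha0]
      have h := h1 0 (by lia) a ha0 x
      simp only [iteratedDeriv_zero, Nat.cast_zero, neg_zero, zero_sub] at h
      calc a⁻¹ * ‖g a x‖ ≤ a⁻¹ * (C * a ^ (-1 : ℝ)) := by gcongr
        _ = _ := by ring
  have hzero : ∀ k ≤ N + 1, ∀ a : ℝ, 0 < a → a ≤ 1 →
      ‖iteratedDeriv k (g a) 0‖ ≤ C * a ^ (β - k) := by
    intro k hk a ha ha1
    simpa [zero_rpow hβ'.ne'] using h2 k hk a ha ha1 0 (by simpa using hδ.le)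
  have hcoef : ∀ k ≤ N,
      IntegrableOn (fun a : ℝ => (a : ℂ)⁻¹ * iteratedDeriv k (g a) 0) (Ioi (0:ℝ)) := by
    intro k hk
    have hkN : (k : ℝ) ≤ N := by exact_mod_cast hk
    refine integrableOn_Ioi_zero_of_norm_le_rpow (A := C) (B := 0) (D := C)
      (p := β - k - 1) (q := 0) (s := -k - 1 - 1) (by linarith) (by norm_num)
      (by linarith [(Nat.cast_nonneg k : (0 : ℝ) ≤ k)]) (hinv.mul ?_) ?_ ?_
    · refine aestronglyMeasurable_iteratedDeriv_param (n := N + 1) (δ := δ) ?_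
        (fun x hx => hmeas x hx.le) k (by lia) 0 (by simpa using hδ)
      exact (ae_restrict_iff' measurableSet_Ioi).2 (.of_forall fun a ha => hsm a ha)
    · intro a ha ha1
      rw [norm_ofReal_inv_mul ha, ← inv_mul_rpow ha, zero_mul, add_zero, mul_left_comm]
      have := hzero k (by lia) a ha ha1
      gcongr
    · intro a ha
      have ha0 : 0 < a := zero_lt_one.trans ha
      rw [norm_ofReal_inv_mul ha0, ← inv_mul_rpow ha0, mul_left_comm]
      have := h1 k (by lia) a ha0 0
      gcongr
  refine ⟨hint, ∑ k ∈ Finset.range (N + 1), Polynomial.monomial k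
    (((k.factorial : ℝ)⁻¹ : ℂ) * ∫ a in Ioi (0:ℝ), (a : ℂ)⁻¹ * iteratedDeriv k (g a) 0), ?_, ?_⟩
  · refine Polynomial.natDegree_sum_le_of_forall_le _ _ fun k hk => ?_
    exact (Polynomial.natDegree_monomial_le _).trans (by simpa [Nat.lt_succ_iff] using hk)
  set K₀ : ℝ := C / β + C / (β - β') + ∑ k ∈ Finset.range (N + 1), C / (β - k) with hK₀
  set K₁ : ℝ := 2 * C / (N + 1 - β) with hK₁
  have hsumpos : 0 ≤ ∑ k ∈ Finset.range (N + 1), C / (β - k) := by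
    refine Finset.sum_nonneg fun k hk => div_nonneg hC.le ?_
    have : (k : ℝ) ≤ N := by exact_mod_cast Nat.lt_succ_iff.1 (Finset.mem_range.1 hk)
    linarith
  have hK₀pos : 0 < K₀ := by
    have : 0 < C / β := by positivity
    have : 0 < C / (β - β') := div_pos hC (by linarith)
    linarith
  have hK₁pos : 0 < K₁ := div_pos (by linarith) (by linarith)
  refine ⟨K₀ + K₁, by linarith, min δ 1, lt_min hδ one_pos, fun x hx => ?_⟩
  have hxδ : |x| ≤ δ := (hx.trans_le (min_le_left _ _)).le
  have hx1 : |x| ≤ 1 := (hx.trans_le (min_le_right _ _)).le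
  set R : ℝ → ℂ := fun a => (a : ℂ)⁻¹ * (g a x -
    ∑ k ∈ Finset.range (N + 1), ((k.factorial : ℝ)⁻¹ * x ^ k) • iteratedDeriv k (g a) 0) with hR
  have hRexp : R = fun a : ℝ => (a : ℂ)⁻¹ * g a x - ∑ k ∈ Finset.range (N + 1),
      ((k.factorial : ℝ)⁻¹ * x ^ k) • ((a : ℂ)⁻¹ * iteratedDeriv k (g a) 0) := by
    funext a
    simp only [hR, mul_sub, Finset.mul_sum, mul_smul_comm]
  have hterm : ∀ k ∈ Finset.range (N + 1), IntegrableOn (fun a : ℝ =>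
      ((k.factorial : ℝ)⁻¹ * x ^ k) • ((a : ℂ)⁻¹ * iteratedDeriv k (g a) 0)) (Ioi 0) :=
    fun k hk => (hcoef k (Nat.lt_succ_iff.1 (Finset.mem_range.1 hk))).smul ((k.factorial : ℝ)⁻¹ * x ^ k)
  have hRint : IntegrableOn R (Ioi 0) := by
    rw [hRexp]
    exact (hint x hxδ).sub (integrable_finsetSum _ hterm)
  have hRval : (∫ a in Ioi (0:ℝ), (a : ℂ)⁻¹ * g a x) - (∑ k ∈ Finset.range (N + 1),
      Polynomial.monomial k (((k.factorial : ℝ)⁻¹ : ℂ) *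
        ∫ a in Ioi (0:ℝ), (a : ℂ)⁻¹ * iteratedDeriv k (g a) 0)).eval (x : ℂ)
      = ∫ a in Ioi (0:ℝ), R a := by
    rw [hRexp, integral_sub (hint x hxδ) (integrable_finsetSum _ hterm),
      integral_finsetSum _ hterm, Polynomial.eval_finsetSum]
    congr 1
    refine Finset.sum_congr rfl fun k _ => ?_
    rw [integral_smul, Polynomial.eval_monomial, Complex.real_smul]
    push_cast
    ring
  rw [hRval]
  rcases eq_or_ne x 0 with rfl | hx0
  · have : R = fun _ => 0 := by
      funext a
      have : ∑ k ∈ Finset.range (N + 1), ((k.factorial : ℝ)⁻¹ * (0 : ℝ) ^ k) •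
          iteratedDeriv k (g a) 0 = g a 0 := by
        rw [Finset.sum_eq_single 0]
        · simp
        · intro k _ hk; simp [hk]
        · simp
      rw [hR]
      simp only [this, sub_self, mul_zero]
    simp [this, zero_rpow hβ.ne']
  have hr : 0 < |x| := abs_pos.2 hx0
  have hnear : ‖∫ a in Ioc 0 |x|, R a‖ ≤ K₀ * |x| ^ β := by
    have hi₁ := (integrableOn_Ioc_zero_rpow (p := β - 1) (by linarith) hr.le).const_mul C
    have hi₂ := (integrableOn_Ioc_zero_rpow (p := β - β' - 1) (by linarith) hr.le).const_mul
      (C * |x| ^ β')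
    have hlt : ∀ k ∈ Finset.range (N + 1), -1 < β - k - 1 := fun k hk => by
      have : (k : ℝ) ≤ N := by exact_mod_cast Nat.lt_succ_iff.1 (Finset.mem_range.1 hk)
      linarith
    have hi₃ : ∀ k ∈ Finset.range (N + 1),
        IntegrableOn (fun a : ℝ => C * |x| ^ k * a ^ (β - k - 1)) (Ioc 0 |x|) :=
      fun k hk => (integrableOn_Ioc_zero_rpow (hlt k hk) hr.le).const_mul _
    have hbound := norm_integral_le_of_norm_le (f := R)
      ((hi₁.add hi₂).add (integrable_finsetSum _ hi₃))
      ((ae_restrict_iff' measurableSet_Ioc).2 (.of_forall fun a ha => ?_))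
    · refine hbound.trans_eq ?_
      rw [integral_add' (hi₁.add hi₂) (integrable_finsetSum _ hi₃), integral_add' hi₁ hi₂,
        integral_finsetSum _ hi₃, hK₀, add_mul, add_mul, Finset.sum_mul, integral_const_mul,
        integral_const_mul, integral_Ioc_zero_rpow (by linarith) hr.le,
        integral_Ioc_zero_rpow (by linarith) hr.le]
      congr 1
      · congr 1
        · rw [sub_add_cancel]; ring
        · rw [sub_add_cancel, mul_assoc, ← mul_div_assoc, ← rpow_add hr, add_sub_cancel]; ring
      · refine Finset.sum_congr rfl fun k hk => ?_
        rw [integral_const_mul, integral_Ioc_zero_rpow (hlt k hk) hr.le, sub_add_cancel,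
          mul_assoc, ← mul_div_assoc, ← rpow_natCast, ← rpow_add hr, add_sub_cancel]
        ring
    · have ha0 : 0 < a := ha.1
      have ha1 : a ≤ 1 := ha.2.trans hx1
      have hg := h2 0 (by lia) a ha0 ha1 x hxδ
      simp only [iteratedDeriv_zero, Nat.cast_zero, sub_zero] at hg
      have hs : ‖∑ k ∈ Finset.range (N + 1), ((k.factorial : ℝ)⁻¹ * x ^ k) •
          iteratedDeriv k (g a) 0‖ ≤ ∑ k ∈ Finset.range (N + 1), |x| ^ k * (C * a ^ (β - k)) := by
        refine norm_sum_le_of_le _ fun k hk => ?_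
        have hz := hzero k (Finset.mem_range.1 hk).le a ha0 ha1
        rw [norm_smul, norm_mul, norm_pow, norm_inv, Real.norm_natCast, norm_eq_abs]
        gcongr
        refine mul_le_of_le_one_left (by positivity) (inv_le_one_of_one_le₀ ?_)
        exact_mod_cast k.factorial_pos
      calc ‖R a‖ ≤ a⁻¹ * (C * (a ^ β + a ^ (β - β') * |x| ^ β')
            + ∑ k ∈ Finset.range (N + 1), |x| ^ k * (C * a ^ (β - k))) := by
            rw [hR, norm_ofReal_inv_mul ha0]
            gcongr
            exact (norm_sub_le _ _).trans (add_le_add hg hs)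
        _ = _ := by
            simp only [Pi.add_apply, ← inv_mul_rpow ha0, mul_add, Finset.mul_sum]
            congr 1
            · ring
            · exact Finset.sum_congr rfl fun k _ => by ring
  have hfar : ‖∫ a in Ioi |x|, R a‖ ≤ K₁ * |x| ^ β := by
    have hi := (integrableOn_Ioi_rpow_of_lt (a := β - (N + 1 : ℕ) - 1)
      (by push_cast; linarith) hr).const_mul (2 * C * |x| ^ (N + 1))
    have hbound := norm_integral_le_of_norm_le (f := R) hi
      ((ae_restrict_iff' measurableSet_Ioi).2 (.of_forall fun a ha => ?_))
    · refine hbound.trans_eq ?_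
      rw [integral_const_mul, integral_Ioi_rpow_of_lt (by push_cast; linarith) hr, sub_add_cancel,
        mul_assoc, ← mul_div_assoc, mul_neg, ← rpow_natCast, ← rpow_add hr, add_sub_cancel, hK₁]
      push_cast
      rw [neg_div, ← div_neg, neg_sub]
      ring
    · have hax : |x| ≤ a := le_of_lt ha
      have ha0 : 0 < a := hr.trans ha
      have hM : ∀ y, |y| ≤ |x| →
          ‖iteratedDeriv (N + 1) (g a) y‖ ≤ 2 * C * a ^ (β - (N + 1 : ℕ)) := by
        intro y hy
        rcases le_total a 1 with ha1 | ha1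
        · refine (h2 (N + 1) le_rfl a ha0 ha1 y (hy.trans hxδ)).trans ?_
          have : a ^ (β - β' - (N + 1 : ℕ)) * |y| ^ β' ≤ a ^ (β - (N + 1 : ℕ)) := by
            calc _ ≤ a ^ (β - β' - (N + 1 : ℕ)) * a ^ β' := by
                  gcongr
                  exact hy.trans hax
              _ = _ := by rw [← rpow_add ha0]; congr 1; ring
          nlinarith
        · refine (h1 (N + 1) le_rfl a ha0 y).trans ?_
          have : a ^ (-((N + 1 : ℕ) : ℝ) - 1) ≤ a ^ (β - (N + 1 : ℕ)) :=
            rpow_le_rpow_of_exponent_le ha1 (by linarith)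
          have : 0 < a ^ (β - (N + 1 : ℕ)) := rpow_pos_of_pos ha0 _
          nlinarith
      have htaylor := norm_sub_taylor_sum_le (hsm a ha0) hM
      calc ‖R a‖ ≤ a⁻¹ * (2 * C * a ^ (β - (N + 1 : ℕ)) * |x| ^ (N + 1)) := by
            rw [hR, norm_ofReal_inv_mul ha0]
            gcongr
        _ = _ := by rw [← inv_mul_rpow ha0]; ring
  rw [← Ioc_union_Ioi_eq_Ioi hr.le, setIntegral_union Ioc_disjoint_Ioi_same measurableSet_Ioi
    (hRint.mono_set Ioc_subset_Ioi_self) (hRint.mono_set (Ioi_subset_Ioi hr.le)), add_mul]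
  exact (norm_add_le _ _).trans (add_le_add hnear hfar)
end

section
/- Let N ≥ 1 be an integer. The normalizer of Γ₀(N) in PSL₂(ℝ) acts transitively on ℚ if and only if N = 2^a · 3^b · N' with a < 8, b < 4 and N' square-free and coprime to 6. -/
open Matrix

local notation "SL2R" => Matrix.SpecialLinearGroup (Fin 2) ℝ

/-- Möbius action of `SL₂(ℝ)` on `ℝ ∪ {∞}` (with `none = ∞`). -/
noncomputable def mobROpt (g : SL2R) : Option ℝ → Option ℝ
  | none => if g.1 1 0 = 0 then none else some (g.1 0 0 / g.1 1 0)
  | some x => if g.1 1 0 * x + g.1 1 1 = 0 then none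
      else some ((g.1 0 0 * x + g.1 0 1) / (g.1 1 0 * x + g.1 1 1))

/-- The image of `Γ₀(N)` in `SL₂(ℝ)`: integral matrices with lower-left entry
divisible by `N`. (It is closed under negation, so membership is insensitive to sign.) -/
def Gamma0R (N : ℕ) : Set SL2R :=
  {g : SL2R | (∀ i j, ∃ n : ℤ, g.1 i j = (n : ℝ)) ∧ ∃ n : ℤ, g.1 1 0 = ((N : ℤ) * n : ℤ)}

/-- The (preimage in `SL₂(ℝ)` of the) normalizer of `Γ₀(N)` in `PSL₂(ℝ)`. -/
def normalizerG0 (N : ℕ) : Set SL2R :=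
  {g : SL2R | ∀ γ ∈ Gamma0R N, g * γ * g⁻¹ ∈ Gamma0R N ∧ g⁻¹ * γ * g ∈ Gamma0R N}

theorem mem_Gamma0R_of_val_eq {N : ℕ} {g : SL2R} (a b c d : ℤ)
    (hg : g.1 = !![(a : ℝ), b; N * c, d]) : g ∈ Gamma0R N := by
  refine ⟨fun i j => ?_, c, by simp [hg]⟩
  fin_cases i <;> fin_cases j
  exacts [⟨a, by simp [hg]⟩, ⟨b, by simp [hg]⟩, ⟨N * c, by simp [hg]⟩, ⟨d, by simp [hg]⟩]

theorem val_mul (g k : SL2R) : (g * k).1 = g.1 * k.1 := rfl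

theorem val_inv (g : SL2R) : (g⁻¹).1 = !![g.1 1 1, -g.1 0 1; -g.1 1 0, g.1 0 0] :=
  Matrix.adjugate_fin_two g.1

theorem exists_entries_of_mem_Gamma0R {N : ℕ} {g : SL2R} (hg : g ∈ Gamma0R N) :
    ∃ a b c d : ℤ, g.1 = !![(a : ℝ), b; N * c, d] ∧ a * d - b * (N * c) = 1 := by
  obtain ⟨hint, c, hc⟩ := hg
  obtain ⟨a, ha⟩ := hint 0 0
  obtain ⟨b, hb⟩ := hint 0 1
  obtain ⟨d, hd⟩ := hint 1 1
  refine ⟨a, b, c, d, ?_, ?_⟩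
  · ext i j
    fin_cases i <;> fin_cases j <;> simp [ha, hb, hc, hd]
  · have := g.2
    rw [Matrix.det_fin_two, ha, hb, hc, hd] at this
    exact_mod_cast this

theorem normalizerG0_inv_mem {N : ℕ} {g : SL2R} (hg : g ∈ normalizerG0 N) :
    g⁻¹ ∈ normalizerG0 N := fun γ hγ => by
  simpa using (hg γ hγ).symm

theorem normalizerG0_mul_mem {N : ℕ} {g k : SL2R} (hg : g ∈ normalizerG0 N)
    (hk : k ∈ normalizerG0 N) : g * k ∈ normalizerG0 N := fun γ hγ => by
  simpa [mul_assoc] using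
    And.intro (hg _ (hk γ hγ).1).1 (hk _ (hg γ hγ).2).2

/-- If `g` and `k` send `∞` to finite points, then `g * k⁻¹` sends the image of `∞` under `k` to
its image under `g`. -/
theorem mobROpt_mul_inv (g k : SL2R) (hg : g.1 1 0 ≠ 0) (hk : k.1 1 0 ≠ 0) :
    mobROpt (g * k⁻¹) (some (k.1 0 0 / k.1 1 0)) = some (g.1 0 0 / g.1 1 0) := by
  have hdet := k.2
  rw [Matrix.det_fin_two] at hdet
  have hden : (g * k⁻¹).1 1 0 * (k.1 0 0 / k.1 1 0) + (g * k⁻¹).1 1 1 = g.1 1 0 / k.1 1 0 := by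
    simp [Matrix.SpecialLinearGroup.coe_inv, Matrix.adjugate_fin_two, Matrix.mul_apply,
      Fin.sum_univ_two]
    field_simp
    linear_combination g.1 1 0 * hdet
  have hnum : (g * k⁻¹).1 0 0 * (k.1 0 0 / k.1 1 0) + (g * k⁻¹).1 0 1 = g.1 0 0 / k.1 1 0 := by
    simp [Matrix.SpecialLinearGroup.coe_inv, Matrix.adjugate_fin_two, Matrix.mul_apply,
      Fin.sum_univ_two]
    field_simp
    linear_combination g.1 0 0 * hdet
  simp only [mobROpt, hden, hnum]
  rw [if_neg (div_ne_zero hg hk)]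
  congr 1
  field_simp

theorem dvd_sub_of_dvd_mul_sub_one {h : ℕ} (hh : h ∣ 24) {a d : ℤ}
    (had : (h : ℤ) ∣ a * d - 1) : (h : ℤ) ∣ a - d := by
  have key : ∀ k ∈ Nat.divisors 24, ∀ u v : ZMod k, u * v = 1 → u = v := by
    intro k hk
    have : k = 1 ∨ k = 2 ∨ k = 3 ∨ k = 4 ∨ k = 6 ∨ k = 8 ∨ k = 12 ∨ k = 24 := by
      have := Nat.divisor_le hk
      have := Nat.dvd_of_mem_divisors hk
      interval_cases k <;> omega
    rcases this with rfl | rfl | rfl | rfl | rfl | rfl | rfl | rfl <;> decide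
  rw [← ZMod.intCast_zmod_eq_zero_iff_dvd] at had ⊢
  push_cast at had ⊢
  exact sub_eq_zero.2 <|
    key h (Nat.mem_divisors.2 ⟨hh, by norm_num⟩) _ _ (sub_eq_zero.1 had)

/-- An Atkin–Lehner matrix for `Q`, conjugated by `diag(h, 1)`. -/
noncomputable def conjAtkinLehner (h Q : ℕ) (hh : 0 < h) (hQ : 0 < Q) (x y b d : ℤ)
    (H : Q * x * d - y * b = 1) : SL2R :=
  ⟨!![√Q * x, b / (h * √Q); h * √Q * y, √Q * d], by
    have hQ' : √(Q : ℝ) * √Q = Q := Real.mul_self_sqrt (by positivity)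
    have hs : √(Q : ℝ) ≠ 0 := by positivity
    have hh' : (h : ℝ) ≠ 0 := by positivity
    have H' : (Q * x * d - y * b : ℝ) = 1 := by exact_mod_cast H
    rw [Matrix.det_fin_two_of]
    field_simp
    rw [pow_two, hQ']
    linear_combination H'⟩

theorem conjAtkinLehner_inv (h Q : ℕ) (hh : 0 < h) (hQ : 0 < Q) (x y b d : ℤ)
    (H : Q * x * d - y * b = 1) :
    (conjAtkinLehner h Q hh hQ x y b d H)⁻¹ =
      conjAtkinLehner h Q hh hQ d (-y) (-b) x (by linear_combination H) := by
  apply Subtype.ext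
  rw [val_inv]
  simp [conjAtkinLehner, neg_div]

theorem conjAtkinLehner_conj_mem {h Q e : ℕ} (hh : 0 < h) (hQ : 0 < Q) (h24 : h ∣ 24)
    {x y b d : ℤ} (H : Q * x * d - y * b = 1) (hey : (e : ℤ) ∣ y) {γ : SL2R}
    (hγ : γ ∈ Gamma0R (h ^ 2 * (Q * e))) :
    conjAtkinLehner h Q hh hQ x y b d H * γ * (conjAtkinLehner h Q hh hQ x y b d H)⁻¹ ∈
      Gamma0R (h ^ 2 * (Q * e)) := by
  obtain ⟨α, β, c, δ, hγe, hdet⟩ := exists_entries_of_mem_Gamma0R hγ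
  obtain ⟨k, hk⟩ : (h : ℤ) ∣ α - δ := dvd_sub_of_dvd_mul_sub_one h24
    ⟨β * (h * (Q * e) * c), by push_cast at hdet; linear_combination hdet⟩
  obtain ⟨y, rfl⟩ := hey
  have hk' : (α - δ : ℝ) = h * k := by exact_mod_cast hk
  have hQ' : √(Q : ℝ) ^ 2 = Q := Real.sq_sqrt (by positivity)
  have hs : √(Q : ℝ) ≠ 0 := by positivity
  have hh' : (h : ℝ) ≠ 0 := by positivity
  rw [conjAtkinLehner_inv]
  refine mem_Gamma0R_of_val_eq
    (Q * d * (x * α + b * h * e * c) - (Q * h * x * (e * y) * β + b * δ * (e * y)))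
    (Q * x ^ 2 * β - b ^ 2 * e * c - x * b * k)
    (y * d * k + Q * d ^ 2 * c - e * y ^ 2 * β)
    (-(e * y) * b * α - d * h * Q * e * c * b + h * Q * x * (e * y) * β + Q * d * x * δ) ?_
  rw [val_mul, val_mul, hγe]
  ext i j
  fin_cases i <;> fin_cases j <;>
    simp [conjAtkinLehner, Matrix.mul_apply, Fin.sum_univ_two] <;> field_simp <;>
    simp only [hQ']
  · ring
  · linear_combination (-b * x * Q) * hk'
  · linear_combination (Q * e * y * d) * hk'
  · ring

theorem conjAtkinLehner_mem_normalizerG0 {h Q e : ℕ} (hh : 0 < h) (hQ : 0 < Q) (h24 : h ∣ 24)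
    {x y b d : ℤ} (H : Q * x * d - y * b = 1) (hey : (e : ℤ) ∣ y) :
    conjAtkinLehner h Q hh hQ x y b d H ∈ normalizerG0 (h ^ 2 * (Q * e)) := by
  refine fun γ hγ => ⟨conjAtkinLehner_conj_mem hh hQ h24 H hey hγ, ?_⟩
  rw [conjAtkinLehner_inv]
  convert conjAtkinLehner_conj_mem hh hQ h24 (x := d) (y := -y) (b := -b) (d := x)
    (by linear_combination H) (by simpa using hey) hγ
  rw [conjAtkinLehner_inv]
  simp

/-- If `M` is squarefree and `h ∣ 24`, every rational is the image of `∞` under an element of the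
normalizer of `Γ₀(h² M)`. -/
theorem exists_mem_normalizerG0_map_infty {h M : ℕ} (h24 : h ∣ 24) (hM : Squarefree M) (q : ℚ) :
    ∃ g ∈ normalizerG0 (h ^ 2 * M), g.1 1 0 ≠ 0 ∧ g.1 0 0 / g.1 1 0 = (q : ℝ) := by
  have hh : 0 < h := Nat.pos_of_dvd_of_pos h24 (by norm_num)
  set r : ℚ := h * q with hr
  obtain ⟨Q, hQ⟩ := Nat.gcd_dvd_left M r.den
  set e := M.gcd r.den with he
  have hQpos : 0 < Q := Nat.pos_of_ne_zero fun h0 => hM.ne_zero (by rw [hQ, h0, mul_zero])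
  have hcop : Nat.Coprime Q r.den := by
    have h1 : Nat.Coprime e Q := Nat.coprime_of_squarefree_mul (hQ ▸ hM)
    have h2 : Q.gcd r.den ∣ e :=
      Nat.dvd_gcd ((Nat.gcd_dvd_left _ _).trans ⟨e, by rw [hQ, mul_comm]⟩) (Nat.gcd_dvd_right _ _)
    exact Nat.eq_one_of_dvd_coprimes h1 h2 (Nat.gcd_dvd_left _ _)
  have hcop' : IsCoprime ((Q : ℤ) * r.num) r.den :=
    IsCoprime.mul_left (Nat.isCoprime_iff_coprime.2 hcop) (Rat.isCoprime_num_den r)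
  obtain ⟨d, b, hdb⟩ := hcop'
  have H : Q * r.num * d - r.den * (-b) = 1 := by linear_combination hdb
  refine ⟨conjAtkinLehner h Q hh hQpos r.num r.den (-b) d H, ?_, ?_, ?_⟩
  · have := conjAtkinLehner_mem_normalizerG0 (e := e) hh hQpos h24 H
      (Int.natCast_dvd_natCast.2 (Nat.gcd_dvd_right _ _))
    rwa [mul_comm Q, ← hQ] at this
  · simp [conjAtkinLehner, hh.ne', hQpos.ne']
  · have hs : √(Q : ℝ) ≠ 0 := by positivity
    have hh' : (h : ℝ) ≠ 0 := by positivity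
    have hden : (r.den : ℝ) ≠ 0 := by positivity
    have hq : (r.num : ℝ) / r.den = h * q := by
      rw [← Rat.cast_def, hr]
      push_cast
      rfl
    rw [div_eq_iff hden] at hq
    simp [conjAtkinLehner]
    field_simp
    linear_combination hq

/-- If the normalizer of `Γ₀(N)` moves `0` to `1 / v` where `v² ∣ N`, then `v` divides the
difference of the diagonal entries of every element of `Γ₀(N)`. -/
theorem dvd_sub_of_map_zero {N v : ℕ} (hN0 : N ≠ 0) (hN : v ^ 2 ∣ N) {g : SL2R}
    (hg : g ∈ normalizerG0 N) (hg0 : g.1 0 1 * v = g.1 1 1) {a b c d : ℤ}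
    (H : a * d - b * (N * c) = 1) : (v : ℤ) ∣ a - d := by
  obtain ⟨k, rfl⟩ := hN
  have hdet := g.2
  rw [Matrix.det_fin_two, ← hg0] at hdet
  let n : SL2R := ⟨!![((1 - k * v : ℤ) : ℝ), (k : ℤ); (v ^ 2 * k : ℕ) * (-1 : ℤ), (1 + k * v : ℤ)],
    by
      rw [Matrix.det_fin_two_of]
      push_cast
      ring⟩
  let γ : SL2R := ⟨!![(a : ℝ), b; (v ^ 2 * k : ℕ) * c, d], by
      rw [Matrix.det_fin_two_of]
      exact_mod_cast H⟩
  obtain ⟨-, m, hm⟩ := (hg n (mem_Gamma0R_of_val_eq _ _ _ _ rfl)).2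
  obtain ⟨r, hr⟩ := (hg γ (mem_Gamma0R_of_val_eq _ _ _ _ rfl)).2.1 0 1
  rw [val_mul, val_mul, val_inv] at hm hr
  simp [n, γ, Matrix.mul_apply, Fin.sum_univ_two, ← hg0] at hm hr
  have hk : (k : ℝ) ≠ 0 := Nat.cast_ne_zero.2 (right_ne_zero_of_mul hN0)
  have hv : (v : ℝ) ≠ 0 :=
    Nat.cast_ne_zero.2 (ne_zero_of_dvd_ne_zero hN0 ((Dvd.intro_left _ (sq v).symm).mul_right k))
  have hbm : (g.1 0 1 * v) ^ 2 * m = -1 := by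
    refine mul_left_cancel₀ hk ?_
    linear_combination (-g.1 0 1 ^ 2) * hm -
      k * (g.1 0 1 * (g.1 0 0 * v - g.1 1 0) + 1) * hdet
  refine ⟨k * c - b - r * m, ?_⟩
  have : (a - d : ℝ) = v * (k * c - b - r * m) := by
    refine mul_left_cancel₀ hv ?_
    linear_combination (v * a + v ^ 2 * b - v ^ 2 * k * c - v * d) * hbm - v ^ 2 * m * hr
  exact_mod_cast this

theorem sq_eq_one_of_transitive {N v : ℕ} (hN : N ≠ 0) (hvN : v ^ 2 ∣ N)
    (htrans : ∀ q₁ q₂ : ℚ, ∃ g ∈ normalizerG0 N, mobROpt g (some (q₁ : ℝ)) = some (q₂ : ℝ))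
    (u : (ZMod v)ˣ) : u ^ 2 = 1 := by
  have hv : 0 < v := Nat.pos_of_ne_zero fun h0 => hN (by simpa [h0] using hvN)
  obtain ⟨g, hg, hg0⟩ := htrans 0 (1 / v)
  have hvN' : v ∣ N := (Dvd.intro_left _ (sq v).symm).trans hvN
  have hvR : (v : ℝ) ≠ 0 := by positivity
  have hmap : g.1 0 1 * v = g.1 1 1 := by
    simp only [mobROpt, Rat.cast_zero, mul_zero, zero_add] at hg0
    split_ifs at hg0 with h0
    have := Option.some.inj hg0
    push_cast at this
    field_simp at this
    exact this
  have : NeZero N := ⟨hN⟩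
  obtain ⟨w, rfl⟩ := ZMod.unitsMap_surjective hvN' u
  obtain ⟨a, ha⟩ := ZMod.intCast_surjective (w : ZMod N)
  obtain ⟨d, hd⟩ := ZMod.intCast_surjective ((w⁻¹ : (ZMod N)ˣ) : ZMod N)
  obtain ⟨c, hc⟩ : (N : ℤ) ∣ a * d - 1 := by
    rw [← ZMod.intCast_zmod_eq_zero_iff_dvd]
    push_cast
    rw [ha, hd, Units.mul_inv, sub_self]
  have hdvd := dvd_sub_of_map_zero (a := a) (b := 1) (c := c) (d := d) hN hvN hg hmap
    (by linear_combination hc)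
  have hw : ((a - d : ℤ) : ZMod v) = 0 := (ZMod.intCast_zmod_eq_zero_iff_dvd _ _).2 hdvd
  have ha' : ((ZMod.unitsMap hvN' w : (ZMod v)ˣ) : ZMod v) = a := by
    rw [ZMod.unitsMap_val, ← ha, ZMod.cast_intCast hvN']
  have hd' : (((ZMod.unitsMap hvN' w)⁻¹ : (ZMod v)ˣ) : ZMod v) = d := by
    rw [← map_inv, ZMod.unitsMap_val, ← hd, ZMod.cast_intCast hvN']
  have : ZMod.unitsMap hvN' w = (ZMod.unitsMap hvN' w)⁻¹ := by
    ext
    rw [ha', hd']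
    push_cast at hw
    exact sub_eq_zero.1 hw
  rw [sq]
  nth_rewrite 2 [this]
  exact mul_inv_cancel _

theorem exists_sq_mul_squarefree {a b N' : ℕ} (ha : a < 8) (hb : b < 4) (hN' : Squarefree N')
    (hcop : Nat.Coprime N' 6) :
    ∃ h M : ℕ, h ∣ 24 ∧ Squarefree M ∧ 2 ^ a * 3 ^ b * N' = h ^ 2 * M := by
  refine ⟨2 ^ (a / 2) * 3 ^ (b / 2), 2 ^ (a % 2) * 3 ^ (b % 2) * N', ?_, ?_, ?_⟩
  · exact Nat.mul_dvd_mul (Nat.pow_dvd_pow 2 (by omega : a / 2 ≤ 3))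
      (Nat.pow_dvd_pow 3 (by omega : b / 2 ≤ 1))
  · have h6 : 2 ^ (a % 2) * 3 ^ (b % 2) ∣ 6 := Nat.mul_dvd_mul
      (Nat.pow_dvd_pow 2 (by omega : a % 2 ≤ 1)) (Nat.pow_dvd_pow 3 (by omega : b % 2 ≤ 1))
    have hs6 : Squarefree 6 := by
      exact (Nat.squarefree_mul (by norm_num : Nat.Coprime 2 3)).2
        ⟨Nat.prime_two.squarefree, Nat.prime_three.squarefree⟩
    exact (Nat.squarefree_mul (Nat.Coprime.coprime_dvd_left h6 hcop.symm)).2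
      ⟨hs6.squarefree_of_dvd h6, hN'⟩
  · conv_lhs => rw [← Nat.div_add_mod a 2, ← Nat.div_add_mod b 2]
    ring

theorem stmt14 (N : ℕ) (hN : 1 ≤ N) :
    (∀ q₁ q₂ : ℚ, ∃ g ∈ normalizerG0 N,
        mobROpt g (some (q₁ : ℝ)) = some ((q₂ : ℝ))) ↔
      ∃ a b N' : ℕ, a < 8 ∧ b < 4 ∧ Squarefree N' ∧ Nat.Coprime N' 6 ∧
        N = 2 ^ a * 3 ^ b * N' := by
  refine ⟨fun htrans => ?_, ?_⟩
  · have hN0 : N ≠ 0 := by omega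
    have hsq {v w : ℕ} (hv : v ^ 2 ∣ N) (hw : Nat.Coprime w v) :
        ((w ^ 2 : ℕ) : ZMod v) = (1 : ℕ) := by
      have := congrArg Units.val (sq_eq_one_of_transitive hN0 hv htrans (ZMod.unitOfCoprime w hw))
      simpa using this
    obtain ⟨a, N₁, h2, rfl⟩ := Nat.exists_eq_pow_mul_and_not_dvd hN0 2 (by norm_num)
    have hN₁ : N₁ ≠ 0 := by
      rintro rfl
      simp at h2
    obtain ⟨b, N', h3, rfl⟩ := Nat.exists_eq_pow_mul_and_not_dvd hN₁ 3 (by norm_num)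
    have h2' : ¬ 2 ∣ N' := fun h => h2 (h.mul_left _)
    refine ⟨a, b, N', ?_, ?_, ?_, ?_, by ring⟩
    · by_contra! ha
      have := hsq (v := 16) (w := 3) (((pow_dvd_pow 2 ha).mul_right _)) (by norm_num)
      rw [ZMod.natCast_eq_natCast_iff] at this
      norm_num [Nat.ModEq] at this
    · by_contra! hb
      have := hsq (v := 9) (w := 2) (((pow_dvd_pow 3 hb).mul_right _).mul_left _) (by norm_num)
      rw [ZMod.natCast_eq_natCast_iff] at this
      norm_num [Nat.ModEq] at this
    · rw [Nat.squarefree_iff_prime_squarefree]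
      intro p hp hpN
      have hp2 : p ≠ 2 := by
        rintro rfl
        exact h2' (dvd_of_mul_left_dvd hpN)
      have hp3 : p ≠ 3 := by
        rintro rfl
        exact h3 (dvd_of_mul_left_dvd hpN)
      have := hsq (v := p) (w := 2) ((sq p ▸ hpN).mul_left _ |>.mul_left _)
        ((Nat.coprime_primes Nat.prime_two hp).2 hp2.symm)
      rw [ZMod.natCast_eq_natCast_iff, Nat.ModEq.comm, Nat.modEq_iff_dvd' (by norm_num)] at this
      exact hp3 ((Nat.prime_dvd_prime_iff_eq hp Nat.prime_three).1 this)
    · exact Nat.Coprime.mul_right ((Nat.Prime.coprime_iff_not_dvd Nat.prime_two).2 h2').symm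
        ((Nat.Prime.coprime_iff_not_dvd Nat.prime_three).2 h3).symm
  · rintro ⟨a, b, N', ha, hb, hN', hcop, rfl⟩ q₁ q₂
    obtain ⟨h, M, h24, hM, hN⟩ := exists_sq_mul_squarefree ha hb hN' hcop
    rw [hN]
    obtain ⟨g₁, hg₁, hne₁, hq₁⟩ := exists_mem_normalizerG0_map_infty h24 hM q₁
    obtain ⟨g₂, hg₂, hne₂, hq₂⟩ := exists_mem_normalizerG0_map_infty h24 hM q₂
    refine ⟨g₂ * g₁⁻¹, normalizerG0_mul_mem hg₂ (normalizerG0_inv_mem hg₁), ?_⟩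
    rw [← hq₁, ← hq₂]
    exact mobROpt_mul_inv g₂ g₁ hne₂ hne₁
end
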